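/- arXiv:2604.17711 — 2 statements merged into one kernel-verified Lean document; each statement's English description precedes it below -/
import Mathlib

section
/- Fix p > 1. Let ρ be an absolutely continuous Borel probability measure on X₁ × X₂ with marginals ρ₁, ρ₂, and let μ₁ ∈ P(X₁), μ₂ ∈ P(X₂). Then the shadow of ρ onto Π(μ₁,μ₂) is unique: every shadow of ρ onto Π(μ₁,μ₂) equals the pushforward (T¹, T²)_# ρ, where for i = 1,2 the map Tⁱ is the (ρᵢ-a.e. unique) optimal transport map attaining W_p(ρᵢ, μᵢ), i.e. Tⁱ_# ρᵢ = μᵢ and (∫ ‖xᵢ − Tⁱ(xᵢ)‖_p^p dρᵢ(xᵢ))^{1/p} = W_p(ρᵢ, μᵢ). -/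
open MeasureTheory ProbabilityTheory
open scoped ENNReal

noncomputable section

abbrev Vec (n : ℕ) : Type := Fin n → ℝ

/-- ℓ_p distance on ℝ^n. -/
def lpDist (p : ℝ) {n : ℕ} (x y : Vec n) : ℝ := (∑ i, |x i - y i| ^ p) ^ (1 / p)

/-- product metric d_p on ℝ^{d₁} × ℝ^{d₂}. -/
def prodDist (p : ℝ) {n m : ℕ} (x y : Vec n × Vec m) : ℝ :=
  (lpDist p x.1 y.1 ^ p + lpDist p x.2 y.2 ^ p) ^ (1 / p)

/-- γ is a coupling of α and β. -/
def IsCoupling {E : Type*} [MeasurableSpace E] (γ : Measure (E × E)) (α β : Measure E) : Prop :=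
  IsProbabilityMeasure γ ∧ γ.map Prod.fst = α ∧ γ.map Prod.snd = β

/-- p-Wasserstein distance (p < ∞) w.r.t. a cost/metric c. -/
def Wp {E : Type*} [MeasurableSpace E] (p : ℝ) (c : E → E → ℝ) (α β : Measure E) : ℝ :=
  sInf ((fun γ : Measure (E × E) => (∫ z, c z.1 z.2 ^ p ∂γ) ^ (1 / p)) '' {γ | IsCoupling γ α β})

/-- ∞-Wasserstein distance w.r.t. a cost/metric c. -/
def Winf {E : Type*} [MeasurableSpace E] (c : E → E → ℝ) (α β : Measure E) : ℝ :=
  sInf ((fun γ : Measure (E × E) => essSup (fun z => c z.1 z.2) γ) '' {γ | IsCoupling γ α β})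

/-- q-Wasserstein distance for q ∈ [1,∞]. -/
def Wq {E : Type*} [MeasurableSpace E] (q : ℝ≥0∞) (c : E → E → ℝ) (α β : Measure E) : ℝ :=
  if q = ∞ then Winf c α β else Wp q.toReal c α β

/-- μ is a Borel probability measure concentrated on X. -/
def ProbOn {E : Type*} [MeasurableSpace E] (μ : Measure E) (X : Set E) : Prop :=
  IsProbabilityMeasure μ ∧ μ Xᶜ = 0

/-- ρ is absolutely continuous with Lebesgue density bounded above and below by strictly
positive constants on X, and vanishing off X. -/
def NiceDensityOn {E : Type*} [MeasureSpace E] (ρ : Measure E) (X : Set E) : Prop :=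
  ∃ (f : E → ℝ≥0∞) (c₁ c₂ : ℝ≥0∞), 0 < c₁ ∧ c₂ < ∞ ∧ ρ = volume.withDensity f ∧
    (∀ x ∈ X, c₁ ≤ f x ∧ f x ≤ c₂) ∧ (∀ x ∉ X, f x = 0)

/-- T is an optimal transport map from α to β for W_p w.r.t. cost c. -/
def IsOptMap {E : Type*} [MeasurableSpace E] (p : ℝ) (c : E → E → ℝ) (α β : Measure E)
    (T : E → E) : Prop :=
  Measurable T ∧ α.map T = β ∧ (∫ x, c x (T x) ^ p ∂α) ^ (1 / p) = Wp p c α β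

/-- Π(μ₁, μ₂): couplings of μ₁ and μ₂. -/
def Pi2 {d₁ d₂ : ℕ} (μ₁ : Measure (Vec d₁)) (μ₂ : Measure (Vec d₂)) :
    Set (Measure (Vec d₁ × Vec d₂)) :=
  {π | IsProbabilityMeasure π ∧ π.map Prod.fst = μ₁ ∧ π.map Prod.snd = μ₂}

/-- S is a shadow of ρ onto Π(μ₁,μ₂) for the p-Wasserstein distance. -/
def IsShadow2 (p : ℝ) {d₁ d₂ : ℕ} (ρ : Measure (Vec d₁ × Vec d₂))
    (μ₁ : Measure (Vec d₁)) (μ₂ : Measure (Vec d₂)) (S : Measure (Vec d₁ × Vec d₂)) : Prop :=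
  ∃ (κ₁ : Kernel (Vec d₁) (Vec d₁)) (κ₂ : Kernel (Vec d₂) (Vec d₂)),
    IsMarkovKernel κ₁ ∧ IsMarkovKernel κ₂ ∧
    (∃ γ₁ : Measure (Vec d₁ × Vec d₁),
      (∀ A, MeasurableSet A → γ₁ A = ∫⁻ y, κ₁ y {x | (x, y) ∈ A} ∂(ρ.map Prod.fst)) ∧
      IsCoupling γ₁ μ₁ (ρ.map Prod.fst) ∧
      (∫ z, lpDist p z.1 z.2 ^ p ∂γ₁) ^ (1 / p) = Wp p (lpDist p) μ₁ (ρ.map Prod.fst)) ∧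
    (∃ γ₂ : Measure (Vec d₂ × Vec d₂),
      (∀ A, MeasurableSet A → γ₂ A = ∫⁻ y, κ₂ y {x | (x, y) ∈ A} ∂(ρ.map Prod.snd)) ∧
      IsCoupling γ₂ μ₂ (ρ.map Prod.snd) ∧
      (∫ z, lpDist p z.1 z.2 ^ p ∂γ₂) ^ (1 / p) = Wp p (lpDist p) μ₂ (ρ.map Prod.snd)) ∧
    (∀ A : Set (Vec d₁ × Vec d₂), MeasurableSet A →
      S A = ∫⁻ y, ((κ₁ y.1).prod (κ₂ y.2)) A ∂ρ)

/-- d_{X,p}: product metric on a K-fold product of Euclidean spaces. -/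
def piDist (p : ℝ) {K : ℕ} {d : Fin K → ℕ} (x y : (i : Fin K) → Vec (d i)) : ℝ :=
  (∑ i, lpDist p (x i) (y i) ^ p) ^ (1 / p)

/-- S is a shadow of ρ onto Π(μ₁,…,μ_K) for the p-Wasserstein distance. -/
def IsShadowK (p : ℝ) {K : ℕ} {d : Fin K → ℕ} (ρ : Measure ((i : Fin K) → Vec (d i)))
    (μ : (i : Fin K) → Measure (Vec (d i))) (S : Measure ((i : Fin K) → Vec (d i))) : Prop :=
  ∃ κ : (i : Fin K) → Kernel (Vec (d i)) (Vec (d i)),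
    (∀ i, IsMarkovKernel (κ i)) ∧
    (∀ i, ∃ γ : Measure (Vec (d i) × Vec (d i)),
      (∀ A, MeasurableSet A → γ A = ∫⁻ y, κ i y {x | (x, y) ∈ A} ∂(ρ.map fun z => z i)) ∧
      IsCoupling γ (μ i) (ρ.map fun z => z i) ∧
      (∫ z, lpDist p z.1 z.2 ^ p ∂γ) ^ (1 / p) = Wp p (lpDist p) (μ i) (ρ.map fun z => z i)) ∧
    (∀ A, MeasurableSet A → S A = ∫⁻ y, Measure.pi (fun i => κ i (y i)) A ∂ρ)


open CompactlySupported in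
theorem aux_riesz {X : Type*} [TopologicalSpace X] [T2Space X] [CompactSpace X]
    [MeasurableSpace X] [BorelSpace X] (g : C(X, ℝ) →ₗ[ℝ] ℝ)
    (hg : ∀ f : C(X, ℝ), (∀ x, 0 ≤ f x) → 0 ≤ g f) :
    ∃ γ : Measure X, IsFiniteMeasure γ ∧ ∀ f : C(X, ℝ), ∫ x, f x ∂γ = g f := by
  let L : C_c(X, ℝ) →ₗ[ℝ] ℝ :=
    { toFun := fun f => g f.toContinuousMap
      map_add' := fun f h => by
        rw [← map_add]; rfl
      map_smul' := fun r f => by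
        rw [RingHom.id_apply, ← map_smul]; rfl }
  let Λ : C_c(X, ℝ) →ₚ[ℝ] ℝ := PositiveLinearMap.mk₀ L (fun f hf => hg _ (fun x => hf x))
  have hfin : IsFiniteMeasure (RealRMK.rieszMeasure Λ) := by
    have : IsFiniteMeasureOnCompacts (RealRMK.rieszMeasure Λ) := by
      unfold RealRMK.rieszMeasure; infer_instance
    exact ⟨isCompact_univ.measure_lt_top⟩
  refine ⟨RealRMK.rieszMeasure Λ, hfin, fun f => ?_⟩
  exact RealRMK.integral_rieszMeasure Λ
    ({ toFun := f, hasCompactSupport' := HasCompactSupport.of_compactSpace f } : C_c(X, ℝ))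

/-- integrability of continuous functions on compact spaces -/
theorem aux_int {X : Type*} [TopologicalSpace X] [CompactSpace X]
    [MeasurableSpace X] [BorelSpace X] (μ : Measure X) [IsFiniteMeasure μ] (f : C(X, ℝ)) :
    Integrable f μ :=
  f.continuous.integrable_of_hasCompactSupport (HasCompactSupport.of_compactSpace f)

theorem aux_duality {A : Type*} [MetricSpace A] [CompactSpace A]
    [MeasurableSpace A] [BorelSpace A] (α β : Measure A) [IsProbabilityMeasure α]
    [IsProbabilityMeasure β] (c : C(A × A, ℝ)) :
    ∃ γ : Measure (A × A), IsCoupling γ α β ∧ ∀ ε > 0, ∃ φ ψ : C(A, ℝ),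
      (∀ a b, φ a + ψ b ≤ c (a, b)) ∧ ∫ z, c z ∂γ ≤ ∫ x, φ x ∂α + ∫ x, ψ x ∂β + ε := by
  let D : C(A × A, ℝ) → Set ℝ := fun f =>
    {r | ∃ φ ψ : C(A, ℝ), (∀ a b, f (a, b) ≤ φ a + ψ b) ∧ r = ∫ x, φ x ∂α + ∫ x, ψ x ∂β}
  have key : ∀ (φ ψ : C(A, ℝ)), ∫ x, φ x ∂α + ∫ x, ψ x ∂β
      = ∫ z, (φ z.1 + ψ z.2) ∂(α.prod β) := by
    intro φ ψ
    rw [integral_add]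
    · rw [integral_fun_fst (fun x => φ x), integral_fun_snd (fun x => ψ x)]; simp
    · exact (aux_int α φ).comp_fst β
    · exact (aux_int β ψ).comp_snd α
  have hbd : ∀ f, ∀ r ∈ D f, ∫ z, f z ∂(α.prod β) ≤ r := by
    rintro f r ⟨φ, ψ, h, rfl⟩
    rw [key]
    refine integral_mono (aux_int _ f) ?_ (fun z => h z.1 z.2)
    exact ((aux_int α φ).comp_fst β).add ((aux_int β ψ).comp_snd α)
  have hbb : ∀ f, BddBelow (D f) := fun f => ⟨_, fun r hr => hbd f r hr⟩
  have hne : ∀ f, (D f).Nonempty := by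
    intro f
    refine ⟨_, ContinuousMap.const A ‖f‖, 0, fun a b => ?_, rfl⟩
    simpa using (le_abs_self _).trans (f.norm_coe_le_norm (a, b))
  let q : C(A × A, ℝ) → ℝ := fun f => sInf (D f)
  have hq_le : ∀ f, ∀ φ ψ : C(A, ℝ), (∀ a b, f (a, b) ≤ φ a + ψ b) →
      q f ≤ ∫ x, φ x ∂α + ∫ x, ψ x ∂β := fun f φ ψ h => csInf_le (hbb f) ⟨φ, ψ, h, rfl⟩
  have hq_lt : ∀ f, ∀ ε > 0, ∃ φ ψ : C(A, ℝ), (∀ a b, f (a, b) ≤ φ a + ψ b) ∧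
      ∫ x, φ x ∂α + ∫ x, ψ x ∂β < q f + ε := by
    intro f ε hε
    obtain ⟨r, ⟨φ, ψ, h, rfl⟩, hr⟩ := exists_lt_of_csInf_lt (hne f) (lt_add_of_pos_right (q f) hε)
    exact ⟨φ, ψ, h, hr⟩
  have hq_add : ∀ f g, q (f + g) ≤ q f + q g := by
    intro f g
    refine le_of_forall_pos_le_add fun ε hε => ?_
    obtain ⟨φ, ψ, h, hr⟩ := hq_lt f (ε / 2) (by positivity)
    obtain ⟨φ', ψ', h', hr'⟩ := hq_lt g (ε / 2) (by positivity)
    have := hq_le (f + g) (φ + φ') (ψ + ψ') (fun a b => by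
      have := h a b; have := h' a b
      simp only [ContinuousMap.add_apply]; linarith)
    simp only [ContinuousMap.add_apply] at this
    rw [integral_add (aux_int α φ) (aux_int α φ'), integral_add (aux_int β ψ) (aux_int β ψ')]
      at this
    linarith
  have hq_hom_le : ∀ r : ℝ, 0 < r → ∀ f, q (r • f) ≤ r * q f := by
    intro r hr f
    refine le_of_forall_pos_le_add fun ε hε => ?_
    obtain ⟨φ, ψ, h, hh⟩ := hq_lt f (ε / r) (by positivity)
    have := hq_le (r • f) (r • φ) (r • ψ) (fun a b => by
      have := mul_le_mul_of_nonneg_left (h a b) hr.le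
      simp only [ContinuousMap.smul_apply, smul_eq_mul]; linarith)
    simp only [ContinuousMap.smul_apply, smul_eq_mul, integral_const_mul] at this
    have h2 := mul_lt_mul_of_pos_left hh hr
    have h3 : r * (ε / r) = ε := by field_simp
    nlinarith
  have hq_hom : ∀ r : ℝ, 0 < r → ∀ f, q (r • f) = r * q f := by
    intro r hr f
    refine le_antisymm (hq_hom_le r hr f) ?_
    have := hq_hom_le r⁻¹ (by positivity) (r • f)
    rw [smul_smul, inv_mul_cancel₀ hr.ne', one_smul] at this
    have h2 := mul_le_mul_of_nonneg_left this hr.le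
    rwa [← mul_assoc, mul_inv_cancel₀ hr.ne', one_mul] at h2
  have hq0 : q 0 = 0 := by
    have := hq_hom 2 (by norm_num) 0
    rw [smul_zero] at this; linarith
  let c0 : C(A × A, ℝ) := -c
  have H : ∀ r : ℝ, r • c0 = 0 → (RingHom.id ℝ) r • q c0 = 0 := by
    intro r hr
    rcases smul_eq_zero.mp hr with h | h
    · simp [h]
    · simp [h, hq0]
  let F : C(A × A, ℝ) →ₗ.[ℝ] ℝ := LinearPMap.mkSpanSingleton' c0 (q c0) H
  obtain ⟨g, hgF, hgq⟩ := exists_extension_of_le_sublinear F q hq_hom hq_add (by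
    rintro ⟨x, hx⟩
    obtain ⟨r, rfl⟩ := Submodule.mem_span_singleton.mp hx
    have : F ⟨r • c0, hx⟩ = r * q c0 := by
      have := LinearPMap.mkSpanSingleton'_apply c0 (q c0) H r hx
      rw [RingHom.id_apply, smul_eq_mul] at this
      exact this
    rw [this]
    show r * q c0 ≤ q (r • c0)
    rcases lt_trichotomy r 0 with h | h | h
    · have h1 := hq_hom (-r) (by linarith) c0
      have h2 := hq_add (r • c0) ((-r) • c0)
      rw [neg_smul, add_neg_cancel, hq0] at h2
      rw [neg_smul] at h1
      linarith
    · simp [h, hq0]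
    · rw [hq_hom r h])
  have hgc : g c0 = q c0 := by
    have hx : c0 ∈ F.domain := Submodule.mem_span_singleton_self c0
    rw [hgF ⟨c0, hx⟩]
    have h1 : (1 : ℝ) • c0 ∈ F.domain := by simpa using hx
    have := LinearPMap.mkSpanSingleton'_apply c0 (q c0) H 1 h1
    simp only [one_smul, RingHom.id_apply] at this
    exact this
  have hpos : ∀ f : C(A × A, ℝ), (∀ x, 0 ≤ f x) → 0 ≤ g f := by
    intro f hf
    have h1 := hgq (-f)
    have h2 := hq_le (-f) 0 0 (fun a b => by simpa using hf (a, b))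
    simp only [ContinuousMap.zero_apply, integral_zero, add_zero, map_neg] at h1 h2
    linarith
  obtain ⟨γ, hγfin, hγ⟩ := aux_riesz g hpos
  have hlin : ∀ φ ψ : C(A, ℝ), g (φ.comp ContinuousMap.fst + ψ.comp ContinuousMap.snd)
      = ∫ x, φ x ∂α + ∫ x, ψ x ∂β := by
    intro φ ψ
    apply le_antisymm
    · exact (hgq _).trans (hq_le _ φ ψ (fun a b => le_rfl))
    · have h1 := hgq (-(φ.comp ContinuousMap.fst + ψ.comp ContinuousMap.snd))
      have h2 := hq_le (-(φ.comp ContinuousMap.fst + ψ.comp ContinuousMap.snd)) (-φ) (-ψ)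
        (fun a b => by simp)
      simp only [ContinuousMap.neg_apply, integral_neg] at h2
      rw [map_neg] at h1
      linarith
  have hm1 : γ.map Prod.fst = α := by
    have : IsFiniteMeasure (γ.map Prod.fst) := inferInstance
    refine ext_of_forall_integral_eq_of_IsFiniteMeasure fun φ => ?_
    rw [integral_map measurable_fst.aemeasurable φ.continuous.aestronglyMeasurable]
    have := hlin φ.toContinuousMap 0
    rw [← hγ] at this
    simpa using this
  have hm2 : γ.map Prod.snd = β := by
    have : IsFiniteMeasure (γ.map Prod.snd) := inferInstance
    refine ext_of_forall_integral_eq_of_IsFiniteMeasure fun φ => ?_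
    rw [integral_map measurable_snd.aemeasurable φ.continuous.aestronglyMeasurable]
    have := hlin 0 φ.toContinuousMap
    rw [← hγ] at this
    simpa using this
  have hprob : IsProbabilityMeasure γ := by
    constructor
    have : γ.map Prod.fst Set.univ = 1 := by rw [hm1]; simp
    rwa [Measure.map_apply measurable_fst MeasurableSet.univ] at this
  refine ⟨γ, ⟨hprob, hm1, hm2⟩, fun ε hε => ?_⟩
  obtain ⟨φ, ψ, h, hr⟩ := hq_lt c0 ε hε
  refine ⟨-φ, -ψ, fun a b => ?_, ?_⟩
  · have := h a b
    simp only [c0, ContinuousMap.neg_apply] at this ⊢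
    linarith
  · rw [hγ]
    have : g c0 = - g c := map_neg g c
    simp only [ContinuousMap.neg_apply, integral_neg]
    linarith

/-- The separable cost `∑ |x_i - y_i|^p`. -/
def cst (p : ℝ) {n : ℕ} (x y : Vec n) : ℝ := ∑ i, |x i - y i| ^ p

theorem lpDist_rpow {p : ℝ} (hp : 1 < p) {n : ℕ} (x y : Vec n) :
    lpDist p x y ^ p = cst p x y := by
  unfold lpDist cst
  rw [← Real.rpow_mul (Finset.sum_nonneg fun i _ => by positivity), one_div,
    inv_mul_cancel₀ (by linarith), Real.rpow_one]

theorem cst_nonneg (p : ℝ) {n : ℕ} (x y : Vec n) : 0 ≤ cst p x y :=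
  Finset.sum_nonneg fun i _ => by positivity

theorem cst_comm (p : ℝ) {n : ℕ} (x y : Vec n) : cst p x y = cst p y x := by
  unfold cst; simp_rw [abs_sub_comm]

theorem cst_cont {p : ℝ} (hp : 1 < p) {n : ℕ} :
    Continuous (fun z : Vec n × Vec n => cst p z.1 z.2) := by
  unfold cst
  refine continuous_finsetSum _ fun i _ => ?_
  refine Continuous.rpow_const ?_ (fun z => Or.inr (by linarith))
  fun_prop

theorem aux_map_comap {n : ℕ} {K : Set (Vec n)} (hK : IsCompact K) {α : Measure (Vec n)}
    (hα : ProbOn α K) :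
    IsProbabilityMeasure (α.comap (Subtype.val : K → Vec n)) ∧
      (α.comap (Subtype.val : K → Vec n)).map Subtype.val = α := by
  have h : (α.comap (Subtype.val : K → Vec n)).map Subtype.val = α := by
    rw [map_comap_subtype_coe hK.measurableSet]
    exact Measure.restrict_eq_self_of_ae_mem (by rw [ae_iff]; exact hα.2)
  refine ⟨?_, h⟩
  have := hα.1
  constructor
  have h1 : (α.comap (Subtype.val : K → Vec n)).map Subtype.val Set.univ = 1 := by
    rw [h]; simp
  rwa [Measure.map_apply measurable_subtype_coe MeasurableSet.univ] at h1

theorem aux_dualVec {n : ℕ} {p : ℝ} (hp : 1 < p) {K : Set (Vec n)} (hK : IsCompact K)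
    {α β : Measure (Vec n)} (hα : ProbOn α K) (hβ : ProbOn β K) :
    ∃ γ : Measure (Vec n × Vec n), IsCoupling γ α β ∧ ∀ ε > 0, ∃ φ ψ : C(Vec n, ℝ),
      (∀ a ∈ K, ∀ b ∈ K, φ a + ψ b ≤ cst p a b) ∧
        ∫ z, cst p z.1 z.2 ∂γ ≤ ∫ x, φ x ∂α + ∫ x, ψ x ∂β + ε := by
  obtain ⟨ha1, ha2⟩ := aux_map_comap hK hα
  obtain ⟨hb1, hb2⟩ := aux_map_comap hK hβ
  have : CompactSpace K := isCompact_iff_compactSpace.mp hK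
  set α' := α.comap (Subtype.val : K → Vec n)
  set β' := β.comap (Subtype.val : K → Vec n)
  let c : C(K × K, ℝ) := ⟨fun z => cst p (z.1 : Vec n) (z.2 : Vec n), by
    exact (cst_cont hp).comp (by fun_prop : Continuous fun z : K × K => ((z.1 : Vec n), (z.2 : Vec n)))⟩
  obtain ⟨γ, ⟨hγ0, hγ1, hγ2⟩, hγ⟩ := aux_duality α' β' c
  let e : K × K → Vec n × Vec n := fun z => (z.1, z.2)
  have he : Measurable e := by fun_prop
  refine ⟨γ.map e, ⟨Measure.isProbabilityMeasure_map he.aemeasurable, ?_, ?_⟩, fun ε hε => ?_⟩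
  · rw [Measure.map_map measurable_fst he, ← ha2, ← hγ1, Measure.map_map (by fun_prop) measurable_fst]
    rfl
  · rw [Measure.map_map measurable_snd he, ← hb2, ← hγ2, Measure.map_map (by fun_prop) measurable_snd]
    rfl
  · obtain ⟨φ, ψ, h1, h2⟩ := hγ ε hε
    obtain ⟨φ', rfl⟩ := ContinuousMap.exists_restrict_eq hK.isClosed φ
    obtain ⟨ψ', rfl⟩ := ContinuousMap.exists_restrict_eq hK.isClosed ψ
    refine ⟨φ', ψ', fun a ha b hb => h1 ⟨a, ha⟩ ⟨b, hb⟩, ?_⟩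
    rw [integral_map he.aemeasurable (cst_cont hp).aestronglyMeasurable]
    rw [← ha2, ← hb2, integral_map (by fun_prop) φ'.continuous.aestronglyMeasurable,
      integral_map (by fun_prop) ψ'.continuous.aestronglyMeasurable]
    exact h2

theorem aux_lip1 {p : ℝ} (hp : 1 < p) (M : ℝ) (hM : 0 ≤ M) :
    ∃ L : ℝ, 0 ≤ L ∧ ∀ s t : ℝ, |s| ≤ M → |t| ≤ M → |(|s| ^ p - |t| ^ p)| ≤ L * |s - t| := by
  refine ⟨p * M ^ (p - 1), by positivity, fun s t hs ht => ?_⟩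
  have := Convex.norm_image_sub_le_of_norm_hasDerivWithin_le
    (f := fun x : ℝ => |x| ^ p) (f' := fun x => p * |x| ^ (p - 2) * x) (s := Set.Icc (-M) M)
    (C := p * M ^ (p - 1)) (x := t) (y := s)
    (fun x _ => (hasDerivAt_abs_rpow x hp).hasDerivWithinAt) ?_ (convex_Icc _ _)
    (abs_le.mp ht) (abs_le.mp hs)
  · simpa [Real.norm_eq_abs] using this
  · intro x hx
    have hx' : |x| ≤ M := abs_le.mpr hx
    rw [Real.norm_eq_abs, abs_mul, abs_mul, abs_of_pos (by linarith : 0 < p),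
      abs_of_nonneg (by positivity : 0 ≤ |x| ^ (p - 2)), mul_assoc]
    refine mul_le_mul_of_nonneg_left ?_ (by linarith)
    rcases eq_or_ne x 0 with h | h
    · simp [h]; positivity
    · have h1 : |x| ^ (p - 2) * |x| = |x| ^ (p - 1) := by
        rw [← Real.rpow_add_one (abs_ne_zero.mpr h)]; congr 1; ring
      rw [h1]
      exact Real.rpow_le_rpow (abs_nonneg x) hx' (by linarith)

theorem aux_lip {p : ℝ} (hp : 1 < p) {n : ℕ} (R : ℝ) (hR : 0 ≤ R) :
    ∃ L : ℝ, 0 ≤ L ∧ ∀ x x' y : Vec n, ‖x‖ ≤ R → ‖x'‖ ≤ R → ‖y‖ ≤ R →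
      cst p x y ≤ cst p x' y + L * ‖x - x'‖ := by
  obtain ⟨L, hL, h⟩ := aux_lip1 hp (2 * R) (by linarith)
  refine ⟨n * L, by positivity, fun x x' y hx hx' hy => ?_⟩
  have : ∀ i, |x i - y i| ^ p ≤ |x' i - y i| ^ p + L * ‖x - x'‖ := by
    intro i
    have a1 := (norm_le_pi_norm x i).trans hx
    have a2 := (norm_le_pi_norm x' i).trans hx'
    have a3 := (norm_le_pi_norm y i).trans hy
    have a4 := norm_le_pi_norm (x - x') i
    rw [Real.norm_eq_abs] at a1 a2 a3 a4
    rw [Pi.sub_apply] at a4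
    have b1 : |x i - y i| ≤ 2 * R := (abs_sub _ _).trans (by linarith)
    have b2 : |x' i - y i| ≤ 2 * R := (abs_sub _ _).trans (by linarith)
    have b3 := (le_abs_self _).trans (h _ _ b1 b2)
    rw [show x i - y i - (x' i - y i) = x i - x' i by ring] at b3
    have := mul_le_mul_of_nonneg_left a4 hL
    linarith
  unfold cst
  calc ∑ i, |x i - y i| ^ p ≤ ∑ i, (|x' i - y i| ^ p + L * ‖x - x'‖) :=
        Finset.sum_le_sum fun i _ => this i
    _ = _ := by rw [Finset.sum_add_distrib]; simp; ring

open Filter Topology in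
theorem aux_potential {n : ℕ} {p : ℝ} (hp : 1 < p) {K : Set (Vec n)} (hK : IsCompact K)
    (hne : K.Nonempty) (R : ℝ) (hKR : ∀ x ∈ K, ‖x‖ ≤ R) (φ ψ : ℕ → C(Vec n, ℝ))
    (hle : ∀ k, ∀ a ∈ K, ∀ b ∈ K, φ k a + ψ k b ≤ cst p a b) :
    ∃ (Φ : Vec n → ℝ) (L : NNReal), LipschitzOnWith L Φ (Metric.closedBall 0 R) ∧
      ∀ a ∈ K, ∀ b ∈ K, Tendsto (fun k => cst p a b - φ k a - ψ k b) atTop (𝓝 0) →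
        ∀ x ∈ Metric.closedBall (0 : Vec n) R, Φ x - cst p x b ≤ Φ a - cst p a b := by
  obtain ⟨a0, ha0⟩ := hne
  have hR : 0 ≤ R := (norm_nonneg _).trans (hKR a0 ha0)
  obtain ⟨L, hL, hlip⟩ := aux_lip hp (n := n) R hR
  let P : ℕ → Vec n → ℝ := fun k x => sInf ((fun b => cst p x b - ψ k b) '' K)
  have hbb : ∀ k x, BddBelow ((fun b => cst p x b - ψ k b) '' K) := fun k x =>
    (hK.image (((cst_cont hp).comp (by fun_prop : Continuous fun b : Vec n => (x, b))).sub
      (ψ k).continuous)).bddBelow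
  have hPle : ∀ k x, ∀ b ∈ K, P k x ≤ cst p x b - ψ k b := fun k x b hb =>
    csInf_le (hbb k x) ⟨b, hb, rfl⟩
  have hleP : ∀ k x r, (∀ b ∈ K, r ≤ cst p x b - ψ k b) → r ≤ P k x := by
    intro k x r h
    refine le_csInf ⟨_, a0, ha0, rfl⟩ ?_
    rintro _ ⟨b, hb, rfl⟩
    exact h b hb
  have hPlip : ∀ k x x', ‖x‖ ≤ R → ‖x'‖ ≤ R → P k x ≤ P k x' + L * ‖x - x'‖ := by
    intro k x x' hx hx'
    have : P k x - L * ‖x - x'‖ ≤ P k x' := hleP k x' _ fun b hb => by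
      have h1 := hPle k x b hb
      have h2 := hlip x x' b hx hx' (hKR b hb)
      linarith
    linarith
  let G : ℕ → Vec n → ℝ := fun k x => P k x - P k a0
  have hG : ∀ x : Vec n, ∃ l, ‖x‖ ≤ R →
      Tendsto (fun k => G k x) (hyperfilter ℕ : Filter ℕ) (𝓝 l) := by
    intro x
    by_cases hx : ‖x‖ ≤ R
    · have hmem : ∀ k, G k x ∈ Set.Icc (-(L * ‖x - a0‖)) (L * ‖x - a0‖) := fun k => by
        have h1 := hPlip k x a0 hx (hKR a0 ha0)
        have h2 := hPlip k a0 x (hKR a0 ha0) hx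
        rw [norm_sub_rev] at h2
        constructor <;> simp only [G] <;> linarith
      obtain ⟨l, -, hl⟩ := isCompact_Icc.ultrafilter_le_nhds
        ((hyperfilter ℕ).map (fun k => G k x)) (by
          rw [Filter.le_principal_iff, Ultrafilter.mem_coe, Ultrafilter.mem_map]
          exact Filter.Eventually.of_forall (f := (hyperfilter ℕ : Filter ℕ)) hmem)
      exact ⟨l, fun _ => hl⟩
    · exact ⟨0, fun h => absurd h hx⟩
  choose Φ hΦ using hG
  refine ⟨Φ, ⟨L, hL⟩, ?_, ?_⟩
  · refine LipschitzOnWith.of_le_add_mul _ fun x hx y hy => ?_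
    rw [mem_closedBall_zero_iff] at hx hy
    refine le_of_tendsto_of_tendsto' (hΦ x hx) ((hΦ y hy).add_const _) fun k => ?_
    have := hPlip k x y hx hy
    simp only [G, dist_eq_norm]
    show _ ≤ _ + L * ‖x - y‖
    linarith
  · intro a ha b hb ht x hx
    rw [mem_closedBall_zero_iff] at hx
    have h1 : Tendsto (fun k => cst p a b - φ k a - ψ k b) (hyperfilter ℕ : Filter ℕ) (𝓝 0) :=
      ht.mono_left Nat.hyperfilter_le_atTop
    have h2 := le_of_tendsto_of_tendsto' (hΦ x hx)
      ((((hΦ a (hKR a ha)).add_const (cst p x b - cst p a b))).add h1) (fun k => by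
        have h3 := hPle k x b hb
        have h4 : φ k a ≤ P k a := hleP k a _ fun b' hb' => by
          have := hle k a ha b' hb'
          linarith
        simp only [G]; linarith)
    linarith

/-- inverse of `u ↦ p |u|^(p-2) u`. -/
def invG (p v : ℝ) : ℝ := (v / p) * |v / p| ^ ((2 - p) / (p - 1))

theorem invG_spec {p : ℝ} (hp : 1 < p) (u : ℝ) : invG p (p * |u| ^ (p - 2) * u) = u := by
  unfold invG
  rw [mul_assoc, mul_div_cancel_left₀ _ (by linarith : p ≠ 0)]
  rcases eq_or_ne u 0 with h | h
  · simp [h]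
  have hu : 0 < |u| := abs_pos.mpr h
  have h1 : |(|u| ^ (p - 2) * u)| = |u| ^ (p - 1) := by
    rw [abs_mul, abs_of_nonneg (by positivity : 0 ≤ |u| ^ (p - 2)),
      ← Real.rpow_add_one hu.ne']; congr 1; ring
  rw [h1, ← Real.rpow_mul hu.le, mul_div_cancel₀ _ (by linarith : p - 1 ≠ 0),
    mul_right_comm, ← Real.rpow_add hu]
  simp

theorem invG_meas (p : ℝ) : Measurable (invG p) := by
  unfold invG; fun_prop

theorem aux_contact {n : ℕ} {p : ℝ} (hp : 1 < p) {Φ : Vec n → ℝ} {a b : Vec n} {U : Set (Vec n)}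
    (hU : U ∈ nhds a) (hd : DifferentiableAt ℝ Φ a)
    (h : ∀ x ∈ U, Φ x - cst p x b ≤ Φ a - cst p a b) :
    b = fun i => a i - invG p (fderiv ℝ Φ a (Pi.single i 1)) := by
  have hc : HasFDerivAt (fun x : Vec n => cst p x b)
      (∑ i, (p * |a i - b i| ^ (p - 2) * (a i - b i)) •
        (ContinuousLinearMap.proj i : Vec n →L[ℝ] ℝ)) a := by
    unfold cst
    refine HasFDerivAt.fun_sum fun i _ => ?_
    have h1 : HasFDerivAt (fun x : Vec n => x i - b i)
        (ContinuousLinearMap.proj i : Vec n →L[ℝ] ℝ) a := by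
      exact ((ContinuousLinearMap.proj i : Vec n →L[ℝ] ℝ).hasFDerivAt).sub_const _
    exact (hasDerivAt_abs_rpow (a i - b i) hp).comp_hasFDerivAt a h1
  have hmax : IsLocalMax (fun x => Φ x - cst p x b) a := by
    filter_upwards [hU] with x hx using h x hx
  have h0 := hmax.hasFDerivAt_eq_zero (hd.hasFDerivAt.sub hc)
  funext i
  have h2 : fderiv ℝ Φ a (Pi.single i 1) = p * |a i - b i| ^ (p - 2) * (a i - b i) := by
    have := congrArg (fun l : Vec n →L[ℝ] ℝ => l (Pi.single i 1)) (sub_eq_zero.mp h0)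
    simpa [Pi.single_apply] using this
  rw [h2, invG_spec hp]; ring

theorem aux_int2 {Y : Type*} [TopologicalSpace Y] [T2Space Y] [MeasurableSpace Y]
    [OpensMeasurableSpace Y] [SecondCountableTopology Y]
    {μ : Measure Y} [IsFiniteMeasure μ] {S : Set Y} (hS : IsCompact S) (h : ∀ᵐ y ∂μ, y ∈ S)
    {f : Y → ℝ} (hf : Continuous f) : Integrable f μ := by
  obtain ⟨C, hC⟩ := hS.exists_bound_of_continuousOn hf.continuousOn
  refine Integrable.of_bound hf.aestronglyMeasurable C ?_
  filter_upwards [h] with y hy using hC y hy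

open Filter Topology in
theorem aux_core {n : ℕ} {p : ℝ} (hp : 1 < p) {K : Set (Vec n)} (hK : IsCompact K)
    {α β : Measure (Vec n)} (hα : ProbOn α K) (hβ : ProbOn β K) (hac : α ≪ volume) :
    ∃ (T : Vec n → Vec n) (γ0 : Measure (Vec n × Vec n)), Measurable T ∧ IsCoupling γ0 α β ∧
      (∀ γ, IsCoupling γ α β → ∫ z, cst p z.1 z.2 ∂γ0 ≤ ∫ z, cst p z.1 z.2 ∂γ) ∧
      ∀ γ, IsCoupling γ α β → ∫ z, cst p z.1 z.2 ∂γ ≤ ∫ z, cst p z.1 z.2 ∂γ0 →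
        ∀ᵐ z ∂γ, z.2 = T z.1 := by
  obtain ⟨γ0, hγ0, hdual⟩ := aux_dualVec hp hK hα hβ
  choose φ ψ hle hgapint using fun k : ℕ => hdual ((1 / 2 : ℝ) ^ k) (by positivity)
  have hKne : K.Nonempty := by
    by_contra h
    rw [Set.not_nonempty_iff_eq_empty] at h
    have h1 := hα.2
    have := hα.1
    rw [h, Set.compl_empty, measure_univ] at h1
    exact one_ne_zero h1
  obtain ⟨R, hR⟩ := hK.isBounded.exists_norm_le
  obtain ⟨Φ, L, hΦ, hcon⟩ := aux_potential hp hK hKne (R + 1)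
    (fun x hx => (hR x hx).trans (by linarith)) φ ψ hle
  have hae : ∀ γ, IsCoupling γ α β → (∀ᵐ z ∂γ, z.1 ∈ K) ∧ (∀ᵐ z ∂γ, z.2 ∈ K) := by
    rintro γ ⟨-, h1, h2⟩
    constructor
    · refine ae_of_ae_map (f := Prod.fst) measurable_fst.aemeasurable ?_
      rw [h1, ae_iff]; exact hα.2
    · refine ae_of_ae_map (f := Prod.snd) measurable_snd.aemeasurable ?_
      rw [h2, ae_iff]; exact hβ.2
  have hgap : ∀ γ, IsCoupling γ α β → ∀ k,
      Integrable (fun z : Vec n × Vec n => cst p z.1 z.2 - φ k z.1 - ψ k z.2) γ ∧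
      (∀ᵐ z ∂γ, 0 ≤ cst p z.1 z.2 - φ k z.1 - ψ k z.2) ∧
      ∫ z, (cst p z.1 z.2 - φ k z.1 - ψ k z.2) ∂γ =
        ∫ z, cst p z.1 z.2 ∂γ - ∫ x, φ k x ∂α - ∫ x, ψ k x ∂β := by
    intro γ hγ k
    obtain ⟨ha, hb⟩ := hae γ hγ
    obtain ⟨hpr, h1, h2⟩ := hγ
    have hS : ∀ᵐ z ∂γ, z ∈ K ×ˢ K := by
      filter_upwards [ha, hb] with z h h' using ⟨h, h'⟩
    have i1 : Integrable (fun z : Vec n × Vec n => cst p z.1 z.2) γ :=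
      aux_int2 (hK.prod hK) hS (cst_cont hp)
    have i2 : Integrable (fun z : Vec n × Vec n => φ k z.1) γ :=
      aux_int2 (hK.prod hK) hS (by fun_prop)
    have i3 : Integrable (fun z : Vec n × Vec n => ψ k z.2) γ :=
      aux_int2 (hK.prod hK) hS (by fun_prop)
    refine ⟨(i1.sub i2).sub i3, ?_, ?_⟩
    · filter_upwards [ha, hb] with z h h'
      have := hle k z.1 h z.2 h'
      linarith
    · have e1 : ∫ z, (cst p z.1 z.2 - φ k z.1 - ψ k z.2) ∂γ =
          ∫ z, (cst p z.1 z.2 - φ k z.1) ∂γ - ∫ z, ψ k z.2 ∂γ := integral_sub (i1.sub i2) i3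
      rw [e1, integral_sub i1 i2]
      have e2 : ∫ x, φ k x ∂α = ∫ x, φ k x ∂(γ.map Prod.fst) := by rw [h1]
      have e3 : ∫ x, ψ k x ∂β = ∫ x, ψ k x ∂(γ.map Prod.snd) := by rw [h2]
      rw [e2, e3, integral_map measurable_fst.aemeasurable (φ k).continuous.aestronglyMeasurable,
        integral_map measurable_snd.aemeasurable (ψ k).continuous.aestronglyMeasurable]
  let T : Vec n → Vec n := fun a i => a i - invG p (fderiv ℝ Φ a (Pi.single i 1))
  have hT : Measurable T := by
    refine measurable_pi_lambda _ fun i => ?_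
    exact (measurable_pi_apply i).sub
      ((invG_meas p).comp (measurable_fderiv_apply_const ℝ Φ (Pi.single i 1)))
  refine ⟨T, γ0, hT, hγ0, ?_, ?_⟩
  · intro γ hγ
    have hlim : Tendsto (fun k : ℕ => ∫ z, cst p z.1 z.2 ∂γ + (1 / 2 : ℝ) ^ k) atTop
        (𝓝 (∫ z, cst p z.1 z.2 ∂γ + 0)) :=
      (tendsto_pow_atTop_nhds_zero_of_lt_one (by norm_num) (by norm_num)).const_add _
    rw [add_zero] at hlim
    refine ge_of_tendsto' hlim fun k => ?_
    obtain ⟨-, h1, h2⟩ := hgap γ hγ k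
    have h3 := integral_nonneg_of_ae h1
    have h4 := hgapint k
    linarith
  · intro γ hγ hopt
    have hlint : ∀ k, ∫⁻ z, ENNReal.ofReal (cst p z.1 z.2 - φ k z.1 - ψ k z.2) ∂γ
        ≤ ENNReal.ofReal ((1 / 2 : ℝ) ^ k) := by
      intro k
      obtain ⟨h0, h1, h2⟩ := hgap γ hγ k
      rw [← ofReal_integral_eq_lintegral_ofReal h0 h1]
      refine ENNReal.ofReal_le_ofReal ?_
      have := hgapint k
      linarith
    have hmeas : ∀ k, AEMeasurable
        (fun z : Vec n × Vec n => ENNReal.ofReal (cst p z.1 z.2 - φ k z.1 - ψ k z.2)) γ :=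
      fun k => (hgap γ hγ k).1.aemeasurable.ennreal_ofReal
    have hsum : ∫⁻ z, ∑' k, ENNReal.ofReal (cst p z.1 z.2 - φ k z.1 - ψ k z.2) ∂γ ≠ ⊤ := by
      rw [lintegral_tsum hmeas]
      refine ne_top_of_le_ne_top ?_ (ENNReal.tsum_le_tsum hlint)
      rw [← ENNReal.ofReal_tsum_of_nonneg (fun k => by positivity) summable_geometric_two]
      exact ENNReal.ofReal_ne_top
    have hfin := ae_lt_top' (AEMeasurable.tsum hmeas) hsum
    have hnn : ∀ᵐ z ∂γ, ∀ k, 0 ≤ cst p z.1 z.2 - φ k z.1 - ψ k z.2 :=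
      ae_all_iff.mpr fun k => (hgap γ hγ k).2.1
    have hdiff : ∀ᵐ z ∂γ, z.1 ∈ Metric.closedBall (0 : Vec n) (R + 1) →
        DifferentiableWithinAt ℝ Φ (Metric.closedBall (0 : Vec n) (R + 1)) z.1 := by
      refine ae_of_ae_map (f := Prod.fst)
        (p := fun x => x ∈ Metric.closedBall (0 : Vec n) (R + 1) →
          DifferentiableWithinAt ℝ Φ (Metric.closedBall (0 : Vec n) (R + 1)) x)
        measurable_fst.aemeasurable ?_
      rw [hγ.2.1]
      exact hac.ae_le hΦ.ae_differentiableWithinAt_of_mem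
    obtain ⟨ha, hb⟩ := hae γ hγ
    filter_upwards [hfin, hnn, hdiff, ha, hb] with z h1 h2 h3 h4 h5
    have hU : Metric.closedBall (0 : Vec n) (R + 1) ∈ 𝓝 z.1 := by
      refine mem_of_superset (Metric.isOpen_ball.mem_nhds ?_) Metric.ball_subset_closedBall
      rw [mem_ball_zero_iff]
      linarith [hR z.1 h4]
    refine aux_contact hp hU ((h3 (mem_of_mem_nhds hU)).differentiableAt hU)
      (hcon z.1 h4 z.2 h5 ?_)
    have h6 := ENNReal.tendsto_atTop_zero_of_tsum_ne_top h1.ne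
    have h7 := (ENNReal.tendsto_toReal ENNReal.zero_ne_top).comp h6
    simp only [ENNReal.toReal_zero] at h7
    refine h7.congr fun k => ?_
    exact ENNReal.toReal_ofReal (h2 k)

theorem aux_graph {n : ℕ} {α β : Measure (Vec n)} {γ : Measure (Vec n × Vec n)}
    (hγ : IsCoupling γ α β) {T : Vec n → Vec n} (hT : Measurable T)
    (h : ∀ᵐ z ∂γ, z.2 = T z.1) : γ = α.map (fun x => (x, T x)) := by
  rw [← hγ.2.1, Measure.map_map (by fun_prop) measurable_fst]
  conv_lhs => rw [← Measure.map_id (μ := γ)]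
  refine Measure.map_congr ?_
  filter_upwards [h] with z hz
  simp only [id, Function.comp]
  rw [← hz]

theorem swap_int (p : ℝ) {n : ℕ} (γ : Measure (Vec n × Vec n)) :
    ∫ z, lpDist p z.1 z.2 ^ p ∂(γ.map Prod.swap) = ∫ z, lpDist p z.1 z.2 ^ p ∂γ := by
  have h := integral_map_equiv (μ := γ) (MeasurableEquiv.prodComm : Vec n × Vec n ≃ᵐ Vec n × Vec n)
    (fun z => lpDist p z.1 z.2 ^ p)
  refine h.trans (integral_congr_ae (Filter.Eventually.of_forall fun z => ?_))
  show lpDist p z.2 z.1 ^ p = lpDist p z.1 z.2 ^ p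
  have : lpDist p z.2 z.1 = lpDist p z.1 z.2 := by
    unfold lpDist; simp_rw [abs_sub_comm]
  rw [this]

theorem Wp_comm (p : ℝ) {n : ℕ} (α β : Measure (Vec n)) :
    Wp p (lpDist p) α β = Wp p (lpDist p) β α := by
  have key : ∀ α β : Measure (Vec n),
      ((fun γ : Measure (Vec n × Vec n) => (∫ z, lpDist p z.1 z.2 ^ p ∂γ) ^ (1 / p)) ''
        {γ | IsCoupling γ α β}) ⊆
      ((fun γ : Measure (Vec n × Vec n) => (∫ z, lpDist p z.1 z.2 ^ p ∂γ) ^ (1 / p)) ''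
        {γ | IsCoupling γ β α}) := by
    rintro α β _ ⟨γ, ⟨h0, h1, h2⟩, rfl⟩
    refine ⟨γ.map Prod.swap, ⟨Measure.isProbabilityMeasure_map (by fun_prop), ?_, ?_⟩, ?_⟩
    · rw [Measure.map_map measurable_fst measurable_swap]; exact h2
    · rw [Measure.map_map measurable_snd measurable_swap]; exact h1
    · exact congrArg (· ^ (1 / p)) (swap_int p γ)
  unfold Wp
  rw [Set.Subset.antisymm (key α β) (key β α)]

theorem aux_main {n : ℕ} {p : ℝ} (hp : 1 < p) {K : Set (Vec n)} (hK : IsCompact K)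
    {α β : Measure (Vec n)} (hα : ProbOn α K) (hβ : ProbOn β K) (hac : α ≪ volume) :
    ∃ T : Vec n → Vec n, IsOptMap p (lpDist p) α β T ∧
      ∀ γ, IsCoupling γ α β →
        (∫ z, lpDist p z.1 z.2 ^ p ∂γ) ^ (1 / p) = Wp p (lpDist p) α β →
        ∀ᵐ z ∂γ, z.2 = T z.1 := by
  obtain ⟨T, γ0, hT, hγ0, hmin, huniq⟩ := aux_core hp hK hα hβ hac
  have hnn : ∀ γ : Measure (Vec n × Vec n), 0 ≤ ∫ z, cst p z.1 z.2 ∂γ :=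
    fun γ => integral_nonneg fun z => cst_nonneg p _ _
  have hp' : 0 < 1 / p := by positivity
  have hW : Wp p (lpDist p) α β = (∫ z, cst p z.1 z.2 ∂γ0) ^ (1 / p) := by
    unfold Wp
    simp_rw [lpDist_rpow hp]
    refine IsLeast.csInf_eq ⟨⟨γ0, hγ0, rfl⟩, ?_⟩
    rintro _ ⟨γ, hγ, rfl⟩
    exact Real.rpow_le_rpow (hnn γ0) (hmin γ hγ) hp'.le
  have hg := aux_graph hγ0 hT (huniq γ0 hγ0 le_rfl)
  refine ⟨T, ⟨hT, ?_, ?_⟩, ?_⟩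
  · rw [← hγ0.2.2, hg, Measure.map_map measurable_snd (by fun_prop)]
    rfl
  · rw [hW, hg, integral_map (by fun_prop) (cst_cont hp).aestronglyMeasurable]
    simp_rw [lpDist_rpow hp]
  · intro γ hγ h
    refine huniq γ hγ ?_
    rw [hW] at h
    simp_rw [lpDist_rpow hp] at h
    exact ((Real.rpow_left_inj (hnn γ) (hnn γ0) hp'.ne').mp h).le

theorem aux_uniq {n : ℕ} {p : ℝ} (hp : 1 < p) {α β : Measure (Vec n)} [IsProbabilityMeasure α]
    {T : Vec n → Vec n}
    (h : ∀ γ, IsCoupling γ α β →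
        (∫ z, lpDist p z.1 z.2 ^ p ∂γ) ^ (1 / p) = Wp p (lpDist p) α β →
        ∀ᵐ z ∂γ, z.2 = T z.1) (T' : Vec n → Vec n) (hT' : IsOptMap p (lpDist p) α β T') :
    T' =ᵐ[α] T := by
  obtain ⟨h1, h2, h3⟩ := hT'
  have hm : Measurable (fun x => (x, T' x)) := by fun_prop
  have := h (α.map fun x => (x, T' x)) ⟨Measure.isProbabilityMeasure_map hm.aemeasurable, ?_, ?_⟩ ?_
  · exact ae_of_ae_map hm.aemeasurable this
  · rw [Measure.map_map measurable_fst hm]; exact Measure.map_id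
  · rw [Measure.map_map measurable_snd hm]; exact h2
  · rw [← h3]
    simp_rw [lpDist_rpow hp]
    rw [integral_map hm.aemeasurable (cst_cont hp).aestronglyMeasurable]

theorem aux_kernel {n : ℕ} {p : ℝ} {α β : Measure (Vec n)}
    {T : Vec n → Vec n} (hT : Measurable T)
    (h : ∀ γ, IsCoupling γ α β →
        (∫ z, lpDist p z.1 z.2 ^ p ∂γ) ^ (1 / p) = Wp p (lpDist p) α β →
        ∀ᵐ z ∂γ, z.2 = T z.1) (κ : Kernel (Vec n) (Vec n)) [IsMarkovKernel κ]
    (γ : Measure (Vec n × Vec n))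
    (hκ : ∀ A, MeasurableSet A → γ A = ∫⁻ y, κ y {x | (x, y) ∈ A} ∂α)
    (hγ : IsCoupling γ β α)
    (hopt : (∫ z, lpDist p z.1 z.2 ^ p ∂γ) ^ (1 / p) = Wp p (lpDist p) β α) :
    ∀ᵐ y ∂α, κ y = Measure.dirac (T y) := by
  obtain ⟨h0, h1, h2⟩ := hγ
  have hsw := h (γ.map Prod.swap) ⟨Measure.isProbabilityMeasure_map (by fun_prop), by
      rw [Measure.map_map measurable_fst measurable_swap]; exact h2, by
      rw [Measure.map_map measurable_snd measurable_swap]; exact h1⟩ (by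
      rw [Wp_comm, ← hopt, swap_int])
  have hsw2 : ∀ᵐ z ∂γ, z.1 = T z.2 := ae_of_ae_map measurable_swap.aemeasurable hsw
  have hA : MeasurableSet {z : Vec n × Vec n | z.1 = T z.2}ᶜ :=
    (measurableSet_eq_fun measurable_fst (hT.comp measurable_snd)).compl
  have hz : γ {z : Vec n × Vec n | z.1 = T z.2}ᶜ = 0 := hsw2
  rw [hκ _ hA] at hz
  have hmeas : Measurable fun y => κ y {x | (x, y) ∈ {z : Vec n × Vec n | z.1 = T z.2}ᶜ} :=
    Kernel.measurable_kernel_prodMk_right hA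
  rw [lintegral_eq_zero_iff hmeas] at hz
  filter_upwards [hz] with y hy
  have hy' : ∀ᵐ x ∂(κ y), x = T y := hy
  have e1 : (κ y).map id = (κ y).map (fun _ => T y) := Measure.map_congr hy'
  rw [Measure.map_id, Measure.map_const] at e1
  simpa using e1

/-- For p > 1 and absolutely continuous ρ on X₁ × X₂, the shadow of ρ onto
Π(μ₁,μ₂) is unique and equals (T¹,T²)_# ρ for the (a.e. unique) optimal transport maps
Tⁱ attaining W_p(ρᵢ, μᵢ). -/
theorem shadow_unique_transport_map
    (d₁ d₂ : ℕ) (X₁ : Set (Vec d₁)) (X₂ : Set (Vec d₂))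
    (hX₁c : IsCompact X₁) (hX₂c : IsCompact X₂)
    (hconv : Convex ℝ (X₁ ×ˢ X₂)) (hbd : volume (frontier (X₁ ×ˢ X₂)) = 0)
    (p : ℝ) (hp : 1 < p)
    (ρ : Measure (Vec d₁ × Vec d₂)) (hρ : ProbOn ρ (X₁ ×ˢ X₂)) (hρac : ρ ≪ volume)
    (μ₁ : Measure (Vec d₁)) (μ₂ : Measure (Vec d₂))
    (hμ₁ : ProbOn μ₁ X₁) (hμ₂ : ProbOn μ₂ X₂) :
    ∃ (T₁ : Vec d₁ → Vec d₁) (T₂ : Vec d₂ → Vec d₂),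
      IsOptMap p (lpDist p) (ρ.map Prod.fst) μ₁ T₁ ∧
      IsOptMap p (lpDist p) (ρ.map Prod.snd) μ₂ T₂ ∧
      (∀ T₁', IsOptMap p (lpDist p) (ρ.map Prod.fst) μ₁ T₁' → T₁' =ᵐ[ρ.map Prod.fst] T₁) ∧
      (∀ T₂', IsOptMap p (lpDist p) (ρ.map Prod.snd) μ₂ T₂' → T₂' =ᵐ[ρ.map Prod.snd] T₂) ∧
      ∀ S, IsShadow2 p ρ μ₁ μ₂ S → S = ρ.map (fun z => (T₁ z.1, T₂ z.2)) := by
  have hρp := hρ.1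
  have hac₁ : ρ.map Prod.fst ≪ volume := by
    refine (hρac.map measurable_fst).trans ?_
    exact Measure.quasiMeasurePreserving_fst.absolutelyContinuous
  have hac₂ : ρ.map Prod.snd ≪ volume := by
    refine (hρac.map measurable_snd).trans ?_
    exact Measure.quasiMeasurePreserving_snd.absolutelyContinuous
  have hP₁ : IsProbabilityMeasure (ρ.map Prod.fst) :=
    Measure.isProbabilityMeasure_map measurable_fst.aemeasurable
  have hP₂ : IsProbabilityMeasure (ρ.map Prod.snd) :=
    Measure.isProbabilityMeasure_map measurable_snd.aemeasurable
  have hρ₁ : ProbOn (ρ.map Prod.fst) X₁ := by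
    refine ⟨hP₁, ?_⟩
    rw [Measure.map_apply measurable_fst hX₁c.measurableSet.compl]
    refine measure_mono_null (t := (X₁ ×ˢ X₂)ᶜ) ?_ hρ.2
    intro z hz h
    exact hz h.1
  have hρ₂ : ProbOn (ρ.map Prod.snd) X₂ := by
    refine ⟨hP₂, ?_⟩
    rw [Measure.map_apply measurable_snd hX₂c.measurableSet.compl]
    refine measure_mono_null (t := (X₁ ×ˢ X₂)ᶜ) ?_ hρ.2
    intro z hz h
    exact hz h.2
  obtain ⟨T₁, hT₁, hu₁⟩ := aux_main hp hX₁c hρ₁ hμ₁ hac₁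
  obtain ⟨T₂, hT₂, hu₂⟩ := aux_main hp hX₂c hρ₂ hμ₂ hac₂
  refine ⟨T₁, T₂, hT₁, hT₂, aux_uniq hp hu₁, aux_uniq hp hu₂, ?_⟩
  rintro S ⟨κ₁, κ₂, hκ₁, hκ₂, ⟨γ₁, hg₁, hc₁, ho₁⟩, ⟨γ₂, hg₂, hc₂, ho₂⟩, hS⟩
  have k₁ := ae_of_ae_map measurable_fst.aemeasurable
    (aux_kernel hT₁.1 hu₁ κ₁ γ₁ hg₁ hc₁ ho₁)
  have k₂ := ae_of_ae_map measurable_snd.aemeasurable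
    (aux_kernel hT₂.1 hu₂ κ₂ γ₂ hg₂ hc₂ ho₂)
  have hTm : Measurable (fun z : Vec d₁ × Vec d₂ => (T₁ z.1, T₂ z.2)) :=
    (hT₁.1.comp measurable_fst).prodMk (hT₂.1.comp measurable_snd)
  ext A hA
  rw [hS A hA, Measure.map_apply hTm hA, ← lintegral_indicator_one (hTm hA)]
  refine lintegral_congr_ae ?_
  filter_upwards [k₁, k₂] with z h₁ h₂
  rw [h₁, h₂, Measure.dirac_prod_dirac, Measure.dirac_apply' _ hA]
  rfl

end
end

section
/- Fix p > 1. Let λ be an absolutely continuous Borel probability measure on ℝ^{d₁} × ℝ^{d₂}, let ρ be an absolutely continuous Borel probability measure on X₁ × X₂ with marginals ρ₁, ρ₂, let μ₁ ∈ P(X₁), μ₂ ∈ P(X₂), and let X_ρ ∈ L^p(λ; ℝ^{d₁}×ℝ^{d₂}) be any measurable map with (X_ρ)_# λ = ρ. Consider the problem of minimizing ‖(X₁,X₂) − X_ρ‖_{L^p(λ)} over pairs of measurable maps (X₁,X₂) ∈ L^p(λ) with (X₁)_# λ = μ₁ and (X₂)_# λ = μ₂. Then this problem admits the unique solution (X₁*,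 X₂*) = (T¹ ∘ (X_ρ)₁, T² ∘ (X_ρ)₂), where Tⁱ is the optimal transport map attaining W_p(ρᵢ, μᵢ) and (X_ρ)ᵢ denotes the i-th component of X_ρ; moreover (X₁*, X₂*)_# λ = S(ρ;μ₁,μ₂), the unique shadow of ρ onto Π(μ₁,μ₂), and ‖(X₁*,X₂*) − X_ρ‖_{L^p(λ)} = W_p(ρ, S(ρ;μ₁,μ₂)). -/
open MeasureTheory ProbabilityTheory
open scoped ENNReal

noncomputable section

section OTCore

open Set Filter Topology

variable {E : Type*} [TopologicalSpace E] [MeasurableSpace E]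

lemma integrable_of_compact {F : Type*} [TopologicalSpace F] [MeasurableSpace F] [T2Space F]
    [BorelSpace F]
    {γ : Measure F} [IsFiniteMeasure γ] {Q : Set F} (hQ : IsCompact Q)
    (hγ : γ Qᶜ = 0) {f : F → ℝ} (hf : Continuous f) : Integrable f γ := by
  have h : γ.restrict Q = γ := Measure.restrict_eq_self_of_ae_mem (by
    rw [ae_iff]; exact hγ)
  obtain ⟨M, hM⟩ := hQ.exists_bound_of_continuousOn hf.continuousOn
  have hmeas : AEStronglyMeasurable f γ := by
    rw [← h]
    exact hf.measurable.aemeasurable.aestronglyMeasurable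
  refine Integrable.of_bound hmeas M ?_
  rw [ae_iff]
  refine measure_mono_null ?_ hγ
  intro x hx hxQ
  exact hx (hM x hxQ)

lemma coupling_conc {E : Type*} [MeasurableSpace E] {γ : Measure (E × E)} {α β : Measure E}
    (h : IsCoupling γ α β) {K L : Set E}
    (hKm : MeasurableSet K) (hLm : MeasurableSet L) (hα : α Kᶜ = 0) (hβ : β Lᶜ = 0) :
    γ (K ×ˢ L)ᶜ = 0 := by
  have h1 : γ (Prod.fst ⁻¹' Kᶜ) = 0 := by
    rw [← Measure.map_apply measurable_fst hKm.compl, h.2.1, hα]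
  have h2 : γ (Prod.snd ⁻¹' Lᶜ) = 0 := by
    rw [← Measure.map_apply measurable_snd hLm.compl, h.2.2, hβ]
  refine measure_mono_null ?_ (measure_union_null h1 h2)
  rintro ⟨x, y⟩ hxy
  simp only [mem_compl_iff, mem_prod, not_and_or] at hxy
  exact hxy

end OTCore

section OTCore2

open Set Filter Topology

lemma exists_opt {E : Type*} [MetricSpace E] [SecondCountableTopology E] [MeasurableSpace E]
    [BorelSpace E] {α β : Measure E} (hα : IsProbabilityMeasure α) (hβ : IsProbabilityMeasure β)
    {K L : Set E} (hK : IsCompact K) (hL : IsCompact L) (hαK : α Kᶜ = 0) (hβL : β Lᶜ = 0)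
    {c : E × E → ℝ} (hc : Continuous c) :
    ∃ γ, IsCoupling γ α β ∧ ∀ γ', IsCoupling γ' α β → ∫ z, c z ∂γ ≤ ∫ z, c z ∂γ' := by
  classical
  have hQ : IsCompact (K ×ˢ L) := hK.prod hL
  obtain ⟨M, hM⟩ := hQ.exists_bound_of_continuousOn hc.continuousOn
  let f : BoundedContinuousFunction (E × E) ℝ :=
    BoundedContinuousFunction.ofNormedAddCommGroup (fun z => max (min (c z) M) (-M))
      (by fun_prop) |M| (by
        intro z
        rw [Real.norm_eq_abs, abs_le]
        have h1 := neg_abs_le M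
        have h2 := le_abs_self M
        constructor
        · refine le_trans ?_ (le_max_right _ _)
          linarith
        · refine max_le (le_trans (min_le_right _ _) h2) ?_
          have := neg_abs_le M
          linarith)
  let A : ProbabilityMeasure E := ⟨α, hα⟩
  let B : ProbabilityMeasure E := ⟨β, hβ⟩
  let S : Set (ProbabilityMeasure (E × E)) :=
    {π | π.map (f := Prod.fst) measurable_fst.aemeasurable = A ∧
      π.map (f := Prod.snd) measurable_snd.aemeasurable = B}
  have hS : ∀ π : ProbabilityMeasure (E × E), π ∈ S ↔ IsCoupling (π : Measure (E × E)) α β := by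
    intro π
    constructor
    · rintro ⟨h1, h2⟩
      refine ⟨inferInstance, ?_, ?_⟩
      · simpa [A] using congrArg (fun q : ProbabilityMeasure E => (q : Measure E)) h1
      · simpa [B] using congrArg (fun q : ProbabilityMeasure E => (q : Measure E)) h2
    · rintro ⟨_, h1, h2⟩
      constructor
      · apply ProbabilityMeasure.toMeasure_injective
        simpa [A] using h1
      · apply ProbabilityMeasure.toMeasure_injective
        simpa [B] using h2
  have hconc : ∀ γ : Measure (E × E), IsCoupling γ α β → γ (K ×ˢ L)ᶜ = 0 := fun γ h =>
    coupling_conc h hK.isClosed.measurableSet hL.isClosed.measurableSet hαK hβL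
  have hSc : IsClosed S := by
    refine IsClosed.inter ?_ ?_
    · exact isClosed_singleton.preimage (ProbabilityMeasure.continuous_map continuous_fst)
    · exact isClosed_singleton.preimage (ProbabilityMeasure.continuous_map continuous_snd)
  have hScomp : IsCompact S := by
    have := isCompact_setOfPred_probabilityMeasure_mass_eq_compl_isCompact_le
      (E := E × E) (u := fun _ => 0) (K := fun _ => K ×ˢ L) tendsto_const_nhds (fun _ => hQ)
      (Or.inl inferInstance)
    refine this.of_isClosed_subset hSc ?_
    intro π hπ n
    have := hconc _ ((hS π).1 hπ)
    rw [← ProbabilityMeasure.null_iff_toMeasure_null] at this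
    exact this.le
  have hSne : S.Nonempty := by
    refine ⟨⟨α.prod β, inferInstance⟩, (hS _).2 ?_⟩
    refine ⟨by simp; infer_instance, by simp, by simp⟩
  have hcont : Continuous (fun π : ProbabilityMeasure (E × E) => ∫ z, f z ∂(π : Measure (E × E))) :=
    ProbabilityMeasure.continuous_integral_boundedContinuousFunction f
  obtain ⟨π, hπ, hmin⟩ := hScomp.exists_isMinOn hSne hcont.continuousOn
  have heq : ∀ γ : Measure (E × E), IsCoupling γ α β → ∫ z, f z ∂γ = ∫ z, c z ∂γ := by
    intro γ hγ
    refine integral_congr_ae ?_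
    rw [EventuallyEq, ae_iff]
    refine measure_mono_null ?_ (hconc γ hγ)
    intro z hz hzQ
    apply hz
    have := abs_le.1 (hM z hzQ)
    change max (min (c z) M) (-M) = c z
    rw [min_eq_left this.2, max_eq_left this.1]
  refine ⟨π, (hS π).1 hπ, fun γ' hγ' => ?_⟩
  have hp := hγ'.1
  have := hmin ((hS ⟨γ', hp⟩).2 hγ')
  rw [← heq _ ((hS π).1 hπ), ← heq _ hγ']
  exact this

/-- two-point monotonicity of optimal plans, almost everywhere version. -/
lemma opt_mono_ae {E : Type*} [MeasurableSpace E]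
    {α β : Measure E} {γ : Measure (E × E)} (hγ : IsCoupling γ α β) {c : E × E → ℝ}
    (hc : Measurable c) (hint : ∀ γ', IsCoupling γ' α β → Integrable c γ')
    (hint2 : Integrable (fun w : (E × E) × (E × E) => c (w.1.1, w.2.2)) (γ.prod γ))
    (hopt : ∀ γ', IsCoupling γ' α β → ∫ z, c z ∂γ ≤ ∫ z, c z ∂γ') :
    ∀ᵐ w ∂(γ.prod γ), c w.1 + c w.2 ≤ c (w.1.1, w.2.2) + c (w.2.1, w.1.2) := by
  classical
  have := hγ.1
  set D : Set ((E × E) × (E × E)) :=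
    {w | c (w.1.1, w.2.2) + c (w.2.1, w.1.2) < c w.1 + c w.2} with hD
  have hDm : MeasurableSet D := by
    apply measurableSet_lt <;> fun_prop
  have hswap : ∀ w, Prod.swap w ∈ D ↔ w ∈ D := by
    rintro ⟨⟨x, y⟩, ⟨x', y'⟩⟩
    simp only [hD, mem_ofPred_eq, Prod.swap]
    constructor <;> intro h <;> linarith
  have mpsw : MeasurePreserving (Prod.swap : (E × E) × (E × E) → _) (γ.prod γ) (γ.prod γ) :=
    ⟨measurable_swap, Measure.prod_swap⟩
  have mpsw' : MeasurePreserving (Prod.swap : (E × E) × (E × E) → _)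
      ((γ.prod γ).restrict D) ((γ.prod γ).restrict D) := by
    have := mpsw.restrict_preimage hDm
    have h2 : Prod.swap ⁻¹' D = D := by ext w; exact hswap w
    rwa [h2] at this
  -- the modified plan
  let Y : (E × E) × (E × E) → E := D.piecewise (fun w => w.2.2) (fun w => w.1.2)
  have hY : Measurable Y := Measurable.piecewise hDm (by fun_prop) (by fun_prop)
  let g : (E × E) × (E × E) → E × E := fun w => (w.1.1, Y w)
  have hg : Measurable g := by fun_prop
  have hfst : (γ.prod γ).map Prod.fst = γ := by simp
  have hcoup : IsCoupling ((γ.prod γ).map g) α β := by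
    refine ⟨Measure.isProbabilityMeasure_map hg.aemeasurable, ?_, ?_⟩
    · rw [Measure.map_map measurable_fst hg]
      have : (Prod.fst ∘ g) = (Prod.fst ∘ Prod.fst : (E × E) × (E × E) → E) := rfl
      rw [this, ← Measure.map_map measurable_fst measurable_fst, hfst, hγ.2.1]
    · rw [Measure.map_map measurable_snd hg]
      have h0 : (Prod.snd ∘ g) = Y := rfl
      have h3 : (γ.prod γ).map (fun w => w.1.2) = β := by
        have : (fun w : (E × E) × (E × E) => w.1.2) = Prod.snd ∘ Prod.fst := rfl
        rw [this, ← Measure.map_map measurable_snd measurable_fst, hfst, hγ.2.2]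
      rw [h0, ← h3]
      ext A hA
      rw [Measure.map_apply hY hA, Measure.map_apply (by fun_prop) hA,
        ← measure_inter_add_sdiff _ hDm, ← measure_inter_add_sdiff (_ ⁻¹' A) hDm]
      congr 1
      · have e1 : Y ⁻¹' A ∩ D = (fun w : (E × E) × (E × E) => w.2.2) ⁻¹' A ∩ D := by
          ext w
          simp only [mem_inter_iff, mem_preimage]
          refine and_congr_left fun hw => ?_
          simp [Y, hw]
        rw [e1]
        have : (fun w : (E × E) × (E × E) => w.2.2) ⁻¹' A ∩ D
            = Prod.swap ⁻¹' ((fun w : (E × E) × (E × E) => w.1.2) ⁻¹' A ∩ D) := by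
          ext w
          simp only [mem_inter_iff, mem_preimage, hswap, Prod.fst_swap]
        rw [this, mpsw.measure_preimage]
        refine MeasurableSet.nullMeasurableSet (MeasurableSet.inter ?_ hDm)
        exact measurableSet_preimage (by fun_prop) hA
      · congr 1
        ext w
        simp only [Set.mem_sdiff, mem_preimage]
        refine and_congr_left fun hw => ?_
        simp [Y, hw]
  have hle := hopt _ hcoup
  have hi1 := hint _ hcoup
  have hi0 := hint _ hγ
  rw [integral_map hg.aemeasurable hc.aestronglyMeasurable] at hle
  rw [integrable_map_measure hc.aestronglyMeasurable hg.aemeasurable] at hi1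
  have mpf : MeasurePreserving (Prod.fst : (E × E) × (E × E) → _) (γ.prod γ) γ :=
    ⟨measurable_fst, hfst⟩
  have i1 : Integrable (fun w : (E × E) × (E × E) => c w.1) (γ.prod γ) :=
    mpf.integrable_comp_of_integrable hi0
  have e0 : ∫ z, c z ∂γ = ∫ w, c w.1 ∂(γ.prod γ) := by
    conv_lhs => rw [← hfst]
    rw [integral_map measurable_fst.aemeasurable hc.aestronglyMeasurable]
  change _ ≤ ∫ w, (c ∘ g) w ∂(γ.prod γ) at hle
  rw [e0, ← integral_add_compl hDm i1, ← integral_add_compl hDm hi1] at hle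
  have c1 : ∫ w in Dᶜ, (c ∘ g) w ∂(γ.prod γ) = ∫ w in Dᶜ, c w.1 ∂(γ.prod γ) := by
    refine setIntegral_congr_fun hDm.compl fun w hw => ?_
    have hw' : w ∉ D := hw
    simp [g, Y, hw']
  have c2 : ∫ w in D, (c ∘ g) w ∂(γ.prod γ) = ∫ w in D, c (w.1.1, w.2.2) ∂(γ.prod γ) := by
    refine setIntegral_congr_fun hDm fun w hw => ?_
    simp [g, Y, hw]
  have hle2 : ∫ w in D, c w.1 ∂(γ.prod γ) ≤ ∫ w in D, c (w.1.1, w.2.2) ∂(γ.prod γ) := by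
    have c1' : ∫ w in Dᶜ, c (g w) ∂(γ.prod γ) = ∫ w in Dᶜ, c w.1 ∂(γ.prod γ) := c1
    have c2' : ∫ w in D, c (g w) ∂(γ.prod γ) = _ := c2
    simp only [Function.comp_def] at hle
    rw [c1', c2'] at hle
    linarith
  have s1 : ∫ w in D, c w.2 ∂(γ.prod γ) = ∫ w in D, c w.1 ∂(γ.prod γ) := by
    have := mpsw'.integral_comp' (f := MeasurableEquiv.prodComm) (fun w => c w.1)
    exact this
  have s2 : ∫ w in D, c (w.2.1, w.1.2) ∂(γ.prod γ) = ∫ w in D, c (w.1.1, w.2.2) ∂(γ.prod γ) := by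
    have := mpsw'.integral_comp' (f := MeasurableEquiv.prodComm) (fun w => c (w.1.1, w.2.2))
    exact this
  have j1 := i1.integrableOn (s := D)
  have j2 := hint2.integrableOn (s := D)
  have j1' : IntegrableOn (fun w : (E × E) × (E × E) => c w.2) D (γ.prod γ) :=
    mpsw'.integrable_comp_of_integrable j1
  have j2' : IntegrableOn (fun w : (E × E) × (E × E) => c (w.2.1, w.1.2)) D (γ.prod γ) :=
    mpsw'.integrable_comp_of_integrable j2
  let F : (E × E) × (E × E) → ℝ := fun w => (c w.1 + c w.2) - (c (w.1.1, w.2.2) + c (w.2.1, w.1.2))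
  have hF : ∫ w in D, F w ∂(γ.prod γ) ≤ 0 := by
    have : ∫ w in D, F w ∂(γ.prod γ) =
      ((∫ w in D, c w.1 ∂(γ.prod γ)) + ∫ w in D, c w.2 ∂(γ.prod γ)) -
      ((∫ w in D, c (w.1.1, w.2.2) ∂(γ.prod γ)) + ∫ w in D, c (w.2.1, w.1.2) ∂(γ.prod γ)) := by
      rw [← integral_add j1 j1', ← integral_add j2 j2']
      exact integral_sub (j1.add j1') (j2.add j2')
    rw [this, s1, s2]
    linarith
  have hFi : IntegrableOn F D (γ.prod γ) := (j1.add j1').sub (j2.add j2')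
  have hFpos : ∀ w ∈ D, 0 < F w := fun w hw => by
    have : c (w.1.1, w.2.2) + c (w.2.1, w.1.2) < c w.1 + c w.2 := hw
    simp only [F]; linarith
  have hD0 : (γ.prod γ) D = 0 := by
    by_contra hne
    have := (setIntegral_pos_iff_support_of_nonneg_ae
      ((ae_restrict_iff' hDm).2 (ae_of_all _ fun w hw => (hFpos w hw).le)) hFi).2 (by
        have : Function.support F ∩ D = D := by
          ext w; constructor
          · exact fun h => h.2
          · exact fun h => ⟨(hFpos w h).ne', h⟩
        rw [this]
        exact pos_iff_ne_zero.2 hne)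
    linarith
  rw [ae_iff]
  refine measure_mono_null ?_ hD0
  intro w hw
  exact not_le.1 hw

lemma opt_mono {E : Type*} [MetricSpace E] [SecondCountableTopology E] [MeasurableSpace E]
    [BorelSpace E] {γ : Measure (E × E)} [SFinite γ] {c : E × E → ℝ} (hc : Continuous c)
    (h : ∀ᵐ w ∂(γ.prod γ), c w.1 + c w.2 ≤ c (w.1.1, w.2.2) + c (w.2.1, w.1.2)) :
    ∀ z ∈ γ.support, ∀ z' ∈ γ.support, c z + c z' ≤ c (z.1, z'.2) + c (z'.1, z.2) := by
  intro z hz z' hz'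
  by_contra hlt
  rw [not_le] at hlt
  have ho : IsOpen {w : (E × E) × (E × E) | c (w.1.1, w.2.2) + c (w.2.1, w.1.2) < c w.1 + c w.2} :=
    isOpen_lt (by fun_prop) (by fun_prop)
  obtain ⟨U, hU, V, hV, hUV⟩ := mem_nhds_prod_iff.1 (ho.mem_nhds (show (z, z') ∈ _ from hlt))
  rw [Measure.mem_support_iff_forall] at hz hz'
  have hpos : 0 < (γ.prod γ) (U ×ˢ V) := by
    rw [Measure.prod_prod]
    exact ENNReal.mul_pos (hz U hU).ne' (hz' V hV).ne'
  rw [ae_iff] at h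
  refine hpos.ne' (measure_mono_null ?_ h)
  intro w hw
  exact not_le.2 (hUV hw)

end OTCore2

section Density

open Set Filter Topology Metric

lemma absrpow_deriv_strictMono {p : ℝ} (hp : 1 < p) :
    StrictMono (deriv (fun a : ℝ => |a| ^ p)) := by
  have hd : deriv (fun a : ℝ => |a| ^ p) = fun a => p * |a| ^ (p - 2) * a := by
    ext a; exact (hasDerivAt_abs_rpow a hp).deriv
  rw [hd]
  refine strictMono_of_odd_strictMonoOn_nonneg (fun a => by simp) ?_
  have h2 : StrictMonoOn (fun a : ℝ => p * a ^ (p - 1)) (Ici 0) := by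
    intro a ha b hb hab
    have := Real.rpow_lt_rpow ha hab (show 0 < p - 1 by linarith)
    have hp0 : 0 < p := by linarith
    simp only
    gcongr
  refine h2.congr ?_
  intro a ha
  rcases eq_or_lt_of_le (show (0 : ℝ) ≤ a from ha) with h | h
  · subst h
    simp [Real.zero_rpow (show p - 1 ≠ 0 by linarith)]
  · simp only
    rw [abs_of_pos h, mul_assoc]
    congr 1
    nth_rewrite 3 [← Real.rpow_one a]
    rw [← Real.rpow_add h]
    ring_nf

lemma absrpow_deriv_continuous {p : ℝ} (hp : 1 < p) :
    Continuous (deriv (fun a : ℝ => |a| ^ p)) := by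
  have : ContDiff ℝ 1 (fun a : ℝ => ‖a‖ ^ p) := contDiff_norm_rpow hp
  exact this.continuous_deriv le_rfl

lemma absrpow_convex {p : ℝ} (hp : 1 < p) (a b : ℝ) :
    deriv (fun a : ℝ => |a| ^ p) a * (b - a) ≤ |b| ^ p - |a| ^ p := by
  have hconv : ConvexOn ℝ univ (fun a : ℝ => |a| ^ p) :=
    ((absrpow_deriv_strictMono hp).strictConvexOn_univ_of_deriv
      (Continuous.rpow_const continuous_abs fun _ => Or.inr (by linarith))).convexOn
  have hd : DifferentiableAt ℝ (fun a : ℝ => |a| ^ p) a :=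
    (hasDerivAt_abs_rpow a hp).differentiableAt
  rcases lt_trichotomy a b with h | h | h
  · have := hconv.deriv_le_slope (mem_univ _) (mem_univ _) h hd
    rw [slope_def_field, le_div_iff₀ (by linarith)] at this
    exact this
  · subst h; simp
  · have := hconv.slope_le_deriv (mem_univ _) (mem_univ _) h hd
    rw [slope_def_field, div_le_iff₀ (by linarith)] at this
    linarith

/-- p-th power of the ℓ_p cost. -/
def hcost (p : ℝ) {n : ℕ} (z : Vec n × Vec n) : ℝ := ∑ i, |z.1 i - z.2 i| ^ p

lemma hcost_continuous {p : ℝ} (hp : 1 < p) (n : ℕ) :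
    Continuous (hcost p : Vec n × Vec n → ℝ) := by
  unfold hcost
  refine continuous_finsetSum _ fun i _ => ?_
  exact Continuous.rpow_const (by fun_prop) fun _ => Or.inr (by linarith)

lemma density_prop {n : ℕ} (A : Set (Vec n)) (K : ℕ) :
    ∀ᵐ x : Vec n, x ∈ A → ∀ (v : Vec n) (ε : ℝ), 0 < ε → ‖v‖ ≤ K * ε →
      ∀ᶠ t in 𝓝[>] (0 : ℝ), (A ∩ closedBall (x + t • v) (t * ε)).Nonempty := by
  have h := IsUnifLocDoublingMeasure.ae_tendsto_measure_inter_div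
    (volume : Measure (Vec n)) A (K : ℝ)
  have h' := ae_imp_of_ae_restrict h
  filter_upwards [h'] with x hx hxA v ε hε hv
  have h1 : Tendsto (fun t : ℝ => t * ε) (𝓝[>] 0) (𝓝[>] 0) := by
    refine tendsto_nhdsWithin_iff.2 ⟨?_, ?_⟩
    · have : Tendsto (fun t : ℝ => t * ε) (𝓝 0) (𝓝 (0 * ε)) :=
        (continuous_id.mul continuous_const).tendsto 0
      rw [zero_mul] at this
      exact this.mono_left nhdsWithin_le_nhds
    · filter_upwards [self_mem_nhdsWithin] with t ht
      exact mul_pos ht hε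
  have h2 := hx hxA (fun t : ℝ => x + t • v) (fun t => t * ε) h1 (by
    filter_upwards [self_mem_nhdsWithin] with t ht
    have ht' : 0 < t := ht
    rw [mem_closedBall, dist_eq_norm]
    have : x - (x + t • v) = -(t • v) := by abel
    rw [this, norm_neg, norm_smul, Real.norm_of_nonneg ht'.le]
    nlinarith)
  have h3 := h2.eventually (lt_mem_nhds (show (0 : ℝ≥0∞) < 1 by norm_num))
  filter_upwards [h3] with t ht
  apply nonempty_of_measure_ne_zero (μ := (volume : Measure (Vec n)))
  intro h0
  rw [h0] at ht
  simp at ht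

lemma mono_graph {p : ℝ} (hp : 1 < p) {n : ℕ} (Γ : Set (Vec n × Vec n))
    (hΓ : ∀ z ∈ Γ, ∀ z' ∈ Γ,
      hcost p z + hcost p z' ≤ hcost p (z.1, z'.2) + hcost p (z'.1, z.2)) :
    ∀ᵐ x : Vec n, ∀ y₀ y₁, (x, y₀) ∈ Γ → (x, y₁) ∈ Γ → y₀ = y₁ := by
  set G := deriv (fun a : ℝ => |a| ^ p) with hG
  have hGc : Continuous G := absrpow_deriv_continuous hp
  have hGi : Function.Injective G := (absrpow_deriv_strictMono hp).injective
  have key : ∀ᵐ x : Vec n, ∀ B ∈ TopologicalSpace.countableBasis (Vec n), ∀ K : ℕ,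
      x ∈ {x | ∃ y ∈ B, (x, y) ∈ Γ} → ∀ (v : Vec n) (ε : ℝ), 0 < ε → ‖v‖ ≤ K * ε →
      ∀ᶠ t in 𝓝[>] (0 : ℝ),
        ({x | ∃ y ∈ B, (x, y) ∈ Γ} ∩ closedBall (x + t • v) (t * ε)).Nonempty := by
    rw [ae_ball_iff (TopologicalSpace.countable_countableBasis _)]
    intro B _
    rw [ae_all_iff]
    intro K
    exact density_prop _ K
  filter_upwards [key] with x hx y₀ y₁ h₀ h₁
  by_contra hne
  let v : Vec n := fun i => G (x i - y₀ i) - G (x i - y₁ i)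
  let F : Vec n × (Vec n × Vec n) → ℝ :=
    fun q => ∑ i, (G (x i - q.1 i) - G (q.2.1 i - y₁ i)) * q.2.2 i
  have hF : Continuous F := by
    refine continuous_finsetSum _ fun i _ => ?_
    fun_prop
  have hpos : 0 < F (y₀, (x, v)) := by
    obtain ⟨i, hi⟩ := Function.ne_iff.1 hne
    refine Finset.sum_pos' (fun j _ => mul_self_nonneg _) ⟨i, Finset.mem_univ _, ?_⟩
    refine mul_self_pos.2 ?_
    rw [sub_ne_zero]
    intro h
    have := hGi h
    apply hi
    linarith
  have hnh : {q | 0 < F q} ∈ 𝓝 (y₀, (x, v)) := (isOpen_lt continuous_const hF).mem_nhds hpos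
  obtain ⟨U, hU, W, hW, hUW⟩ := mem_nhds_prod_iff.1 hnh
  obtain ⟨W₁, hW₁, W₂, hW₂, hWW⟩ := mem_nhds_prod_iff.1 hW
  obtain ⟨B, hB, hyB, hBU⟩ := (TopologicalSpace.isBasis_countableBasis (Vec n)).mem_nhds_iff.1 hU
  obtain ⟨δ, hδ, hδW⟩ := Metric.mem_nhds_iff.1 hW₁
  obtain ⟨ε, hε, hεW⟩ := Metric.nhds_basis_closedBall.mem_iff.1 hW₂
  obtain ⟨K, hK⟩ := exists_nat_ge (‖v‖ / ε)
  have ev := hx B hB K ⟨y₀, hyB, h₀⟩ v ε hε (by rwa [div_le_iff₀ hε] at hK)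
  have ev2 : ∀ᶠ t in 𝓝[>] (0 : ℝ), t * (‖v‖ + ε) < δ := by
    have : Tendsto (fun t : ℝ => t * (‖v‖ + ε)) (𝓝 0) (𝓝 (0 * (‖v‖ + ε))) :=
      (continuous_id.mul continuous_const).tendsto 0
    rw [zero_mul] at this
    exact (this.mono_left nhdsWithin_le_nhds).eventually (gt_mem_nhds hδ)
  obtain ⟨t, ⟨⟨x', ⟨y', hy'B, hxy'⟩, hx'⟩, ht2⟩, ht⟩ :=
    ((ev.and ev2).and self_mem_nhdsWithin).exists
  have ht0 : 0 < t := ht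
  let u : Vec n := t⁻¹ • (x' - x)
  have hxu : x' - x = t • u := by simp [u, smul_smul, ht0.ne']
  have huv : ‖u - v‖ ≤ ε := by
    rw [mem_closedBall, dist_eq_norm] at hx'
    have e : x' - (x + t • v) = t • (u - v) := by
      rw [smul_sub, ← hxu]; abel
    rw [e, norm_smul, Real.norm_of_nonneg ht0.le] at hx'
    exact le_of_mul_le_mul_left hx' ht0
  have hx'W : x' ∈ W₁ := by
    apply hδW
    rw [mem_ball, dist_eq_norm, hxu, norm_smul, Real.norm_of_nonneg ht0.le]
    refine lt_of_le_of_lt ?_ ht2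
    have : ‖u‖ ≤ ‖v‖ + ε := by
      have := norm_add_le (u - v) v
      simp only [sub_add_cancel] at this
      linarith
    gcongr
  have huW : u ∈ W₂ := hεW (by rw [mem_closedBall, dist_eq_norm]; exact huv)
  have hFpos : 0 < F (y', (x', u)) := hUW ⟨hBU hy'B, hWW ⟨hx'W, huW⟩⟩
  have hm := hΓ _ h₁ _ hxy'
  have hsum : t * F (y', (x', u)) ≤ (hcost p (x', y') - hcost p (x, y')) +
      (hcost p (x, y₁) - hcost p (x', y₁)) := by
    simp only [F, hcost]
    rw [Finset.mul_sum, ← Finset.sum_sub_distrib, ← Finset.sum_sub_distrib,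
      ← Finset.sum_add_distrib]
    refine Finset.sum_le_sum fun i _ => ?_
    have e : x' i - x i = t * u i := congrFun hxu i
    have a1 := absrpow_convex hp (x i - y' i) (x' i - y' i)
    have a2 := absrpow_convex hp (x' i - y₁ i) (x i - y₁ i)
    rw [← hG] at a1 a2
    have e1 : x' i - y' i - (x i - y' i) = t * u i := by linarith
    have e2 : x i - y₁ i - (x' i - y₁ i) = -(t * u i) := by linarith
    rw [e1] at a1
    rw [e2] at a2
    nlinarith
  have := mul_pos ht0 hFpos
  linarith

end Density

section Core

open Set Filter Topology

lemma graph_eq {E : Type*} [MeasurableSpace E] {γ : Measure (E × E)} {α : Measure E}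
    (h1 : γ.map Prod.fst = α) {T : E → E} (hT : Measurable T) (h : ∀ᵐ z ∂γ, z.2 = T z.1) :
    γ = α.map (fun x => (x, T x)) := by
  rw [← h1, Measure.map_map (by fun_prop) measurable_fst]
  conv_lhs => rw [← Measure.map_id (μ := γ)]
  refine Measure.map_congr ?_
  filter_upwards [h] with z hz
  simp [← hz]

lemma opt_graph {p : ℝ} (hp : 1 < p) {n : ℕ} {α β : Measure (Vec n)}
    (hac : α ≪ volume)
    {K L : Set (Vec n)} (hK : IsCompact K) (hL : IsCompact L) (hαK : α Kᶜ = 0) (hβL : β Lᶜ = 0)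
    {γ : Measure (Vec n × Vec n)} (hγ : IsCoupling γ α β)
    (hopt : ∀ γ', IsCoupling γ' α β → ∫ z, hcost p z ∂γ ≤ ∫ z, hcost p z ∂γ') :
    ∃ T : Vec n → Vec n, Measurable T ∧ ∀ᵐ z ∂γ, z.2 = T z.1 := by
  have := hγ.1
  have hc := hcost_continuous hp n
  have hKm := hK.isClosed.measurableSet
  have hLm := hL.isClosed.measurableSet
  have hmono := opt_mono hc (opt_mono_ae hγ hc.measurable
    (fun γ' hγ' => by
      have := hγ'.1
      exact integrable_of_compact (hK.prod hL) (coupling_conc hγ' hKm hLm hαK hβL) hc)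
    (by
      refine integrable_of_compact ((hK.prod hL).prod (hK.prod hL)) ?_ (by fun_prop)
      have h0 := coupling_conc hγ hKm hLm hαK hβL
      rw [Set.compl_prod_eq_union]
      refine measure_union_null ?_ ?_
      · rw [Measure.prod_prod, h0, zero_mul]
      · rw [Measure.prod_prod, h0, mul_zero]) hopt)
  have hu := hac.ae_le (mono_graph hp _ hmono)
  have hfst : γ.fst = α := hγ.2.1
  have hdis : α ⊗ₘ γ.condKernel = γ := by
    rw [← hfst]; exact γ.disintegrate γ.condKernel
  have hαp : IsProbabilityMeasure α := by
    rw [← hfst]; infer_instance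
  have hs : ∀ᵐ z ∂(α ⊗ₘ γ.condKernel), z ∈ γ.support := by
    rw [hdis]; exact Measure.support_mem_ae
  have hs' := Measure.ae_ae_of_ae_compProd hs
  let T : Vec n → Vec n := fun x => ∫ y, y ∂(γ.condKernel x)
  have hT : Measurable T := by
    have : StronglyMeasurable T := by
      have h : StronglyMeasurable (Function.uncurry fun (_ : Vec n) (y : Vec n) => y) :=
        measurable_snd.stronglyMeasurable
      exact h.integral_kernel_prod_right
    exact this.measurable
  refine ⟨T, hT, ?_⟩
  rw [← hdis, Measure.ae_compProd_iff (measurableSet_eq_fun measurable_snd (by fun_prop))]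
  filter_upwards [hu, hs'] with x hx hsx
  obtain ⟨y₀, hy₀⟩ := hsx.exists
  have hy : ∀ᵐ y ∂(γ.condKernel x), y = y₀ := by
    filter_upwards [hsx] with y hy
    exact hx _ _ hy hy₀
  have hTx : T x = y₀ := by
    change ∫ y, y ∂(γ.condKernel x) = y₀
    rw [integral_congr_ae hy]
    simp
  rw [hTx]
  exact hy

lemma core {p : ℝ} (hp : 1 < p) {n : ℕ} {α β : Measure (Vec n)}
    (hα : IsProbabilityMeasure α) (hβ : IsProbabilityMeasure β) (hac : α ≪ volume)
    {K L : Set (Vec n)} (hK : IsCompact K) (hL : IsCompact L)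
    (hαK : α Kᶜ = 0) (hβL : β Lᶜ = 0) :
    ∃ T : Vec n → Vec n, Measurable T ∧ α.map T = β ∧
      (∀ γ, IsCoupling γ α β → ∫ x, hcost p (x, T x) ∂α ≤ ∫ z, hcost p z ∂γ) ∧
      (∀ γ, IsCoupling γ α β → ∫ z, hcost p z ∂γ ≤ ∫ x, hcost p (x, T x) ∂α →
        ∀ᵐ z ∂γ, z.2 = T z.1) := by
  have hc := hcost_continuous hp n
  obtain ⟨γ, hγ, hopt⟩ := exists_opt hα hβ hK hL hαK hβL hc
  obtain ⟨T, hT, hg⟩ := opt_graph hp hac hK hL hαK hβL hγ hopt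
  have he := graph_eq hγ.2.1 hT hg
  have hcost_eq : ∫ z, hcost p z ∂γ = ∫ x, hcost p (x, T x) ∂α := by
    rw [he, integral_map (by fun_prop) hc.aestronglyMeasurable]
  have hi : ∀ γ', IsCoupling γ' α β → Integrable (hcost p) γ' := fun γ' hγ' => by
    have := hγ'.1
    exact integrable_of_compact (hK.prod hL) (coupling_conc hγ' hK.isClosed.measurableSet
      hL.isClosed.measurableSet hαK hβL) hc
  refine ⟨T, hT, ?_, ?_, ?_⟩
  · rw [← hγ.2.2, he, Measure.map_map measurable_snd (by fun_prop)]
    rfl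
  · intro γ' hγ'
    rw [← hcost_eq]
    exact hopt γ' hγ'
  · intro γ' hγ' hle
    rw [← hcost_eq] at hle
    have hp1 := hγ.1
    have hp2 := hγ'.1
    let ν : Measure (Vec n × Vec n) := (2⁻¹ : ℝ≥0∞) • γ + (2⁻¹ : ℝ≥0∞) • γ'
    have hν : IsCoupling ν α β := by
      refine ⟨⟨?_⟩, ?_, ?_⟩
      · simp [ν, ENNReal.inv_two_add_inv_two]
      · simp only [ν]
        rw [Measure.map_add _ _ measurable_fst, Measure.map_smul, Measure.map_smul,
          hγ.2.1, hγ'.2.1, ← add_smul, ENNReal.inv_two_add_inv_two, one_smul]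
      · simp only [ν]
        rw [Measure.map_add _ _ measurable_snd, Measure.map_smul, Measure.map_smul,
          hγ.2.2, hγ'.2.2, ← add_smul, ENNReal.inv_two_add_inv_two, one_smul]
    have hνc : ∫ z, hcost p z ∂ν ≤ ∫ z, hcost p z ∂γ := by
      simp only [ν]
      rw [integral_add_measure ((hi _ hγ).smul_measure (by simp))
        ((hi _ hγ').smul_measure (by simp)), integral_smul_measure, integral_smul_measure]
      simp only [ENNReal.toReal_inv, ENNReal.toReal_ofNat, smul_eq_mul]
      linarith
    obtain ⟨T', hT', hg'⟩ := opt_graph hp hac hK hL hαK hβL hν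
      (fun γ'' h'' => hνc.trans (hopt γ'' h''))
    simp only [ν] at hg'
    rw [ae_add_measure_iff, Measure.ae_ennreal_smul_measure_iff (by simp),
      Measure.ae_ennreal_smul_measure_iff (by simp)] at hg'
    have e1 := graph_eq hγ.2.1 hT' hg'.1
    have e2 := graph_eq hγ'.2.1 hT' hg'.2
    rw [e2, ← e1]
    exact hg

end Core

section Final

open Set Filter Topology

lemma rpow_inj_aux {a b q : ℝ} (hq : q ≠ 0) (ha : 0 ≤ a) (hb : 0 ≤ b) (h : a ^ q = b ^ q) :
    a = b :=
  (Real.rpow_left_inj ha hb hq).1 h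

lemma hcost_nonneg (p : ℝ) {n : ℕ} (z : Vec n × Vec n) : 0 ≤ hcost p z :=
  Finset.sum_nonneg fun _ _ => Real.rpow_nonneg (abs_nonneg _) _

lemma hcost_comm (p : ℝ) {n : ℕ} (x y : Vec n) : hcost p (x, y) = hcost p (y, x) := by
  simp only [hcost]
  exact Finset.sum_congr rfl fun i _ => by rw [abs_sub_comm]

lemma lpDist_pow {p : ℝ} (hp : 1 < p) {n : ℕ} (x y : Vec n) :
    lpDist p x y ^ p = hcost p (x, y) := by
  have h := hcost_nonneg p (x, y)
  have hp0 : p ≠ 0 := by linarith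
  unfold lpDist
  change (hcost p (x, y) ^ (1 / p)) ^ p = _
  rw [← Real.rpow_mul h, one_div_mul_cancel hp0, Real.rpow_one]

lemma prodDist_pow {p : ℝ} (hp : 1 < p) {n m : ℕ} (x y : Vec n × Vec m) :
    prodDist p x y ^ p = hcost p (x.1, y.1) + hcost p (x.2, y.2) := by
  have hp0 : p ≠ 0 := by linarith
  unfold prodDist
  rw [lpDist_pow hp, lpDist_pow hp, ← Real.rpow_mul (add_nonneg (hcost_nonneg _ _)
    (hcost_nonneg _ _)), one_div_mul_cancel hp0, Real.rpow_one]

/-- T is the optimal map and the optimal plan is unique. -/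
def GoodMap (p : ℝ) {n : ℕ} (α β : Measure (Vec n)) (T : Vec n → Vec n) : Prop :=
  Measurable T ∧ α.map T = β ∧
      (∀ γ, IsCoupling γ α β → ∫ x, hcost p (x, T x) ∂α ≤ ∫ z, hcost p z ∂γ) ∧
      (∀ γ, IsCoupling γ α β → ∫ z, hcost p z ∂γ ≤ ∫ x, hcost p (x, T x) ∂α →
        ∀ᵐ z ∂γ, z.2 = T z.1)

lemma isCoupling_map {Ω E : Type*} [MeasurableSpace Ω] [MeasurableSpace E] {P : Measure Ω}
    [IsProbabilityMeasure P] {α β : Measure E} {A B : Ω → E} (hA : Measurable A) (hB : Measurable B)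
    (h1 : P.map A = α) (h2 : P.map B = β) : IsCoupling (P.map fun ω => (A ω, B ω)) α β := by
  refine ⟨Measure.isProbabilityMeasure_map (by fun_prop), ?_, ?_⟩
  · rw [Measure.map_map measurable_fst (by fun_prop)]; exact h1
  · rw [Measure.map_map measurable_snd (by fun_prop)]; exact h2

section good

variable {p : ℝ} {n : ℕ} {α β : Measure (Vec n)} {T : Vec n → Vec n}
  {Ω : Type*} [MeasurableSpace Ω] {P : Measure Ω} {A B : Ω → Vec n}

lemma hcost_integrable (hp : 1 < p) (P : Measure Ω) [IsProbabilityMeasure P]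
    (hA : Measurable A) (hB : Measurable B) (h1 : P.map A = α) (h2 : P.map B = β)
    {K L : Set (Vec n)} (hK : IsCompact K) (hL : IsCompact L)
    (hαK : α Kᶜ = 0) (hβL : β Lᶜ = 0) : Integrable (fun ω => hcost p (A ω, B ω)) P := by
  have hc := isCoupling_map hA hB h1 h2
  have := hc.1
  have hi := integrable_of_compact (hK.prod hL) (coupling_conc hc hK.isClosed.measurableSet
      hL.isClosed.measurableSet hαK hβL) (hcost_continuous hp n)
  exact (integrable_map_measure (hcost_continuous hp n).aestronglyMeasurable
    (by fun_prop)).1 hi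

lemma integral_hcost_map (hp : 1 < p) (P : Measure Ω) (hA : Measurable A) (hB : Measurable B) :
    ∫ z, hcost p z ∂(P.map fun ω => (A ω, B ω)) = ∫ ω, hcost p (A ω, B ω) ∂P :=
  integral_map (by fun_prop) (hcost_continuous hp n).aestronglyMeasurable

lemma GoodMap.le (hp : 1 < p) (h : GoodMap p α β T) (P : Measure Ω) [IsProbabilityMeasure P]
    (hA : Measurable A) (hB : Measurable B) (h1 : P.map A = α) (h2 : P.map B = β) :
    ∫ x, hcost p (x, T x) ∂α ≤ ∫ ω, hcost p (A ω, B ω) ∂P := by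
  rw [← integral_hcost_map hp P hA hB]
  exact h.2.2.1 _ (isCoupling_map hA hB h1 h2)

lemma GoodMap.uniq (hp : 1 < p) (h : GoodMap p α β T) (P : Measure Ω) [IsProbabilityMeasure P]
    (hA : Measurable A) (hB : Measurable B) (h1 : P.map A = α) (h2 : P.map B = β)
    (hle : ∫ ω, hcost p (A ω, B ω) ∂P ≤ ∫ x, hcost p (x, T x) ∂α) :
    ∀ᵐ ω ∂P, B ω = T (A ω) := by
  rw [← integral_hcost_map hp P hA hB] at hle
  have := h.2.2.2 _ (isCoupling_map hA hB h1 h2) hle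
  exact ae_of_ae_map (f := fun ω => (A ω, B ω)) (by fun_prop) this

lemma GoodMap.cost_eq (hp : 1 < p) (h : GoodMap p α β T) (P : Measure Ω)
    (hA : Measurable A) (h1 : P.map A = α) :
    ∫ ω, hcost p (A ω, T (A ω)) ∂P = ∫ x, hcost p (x, T x) ∂α := by
  have hT := h.1
  rw [← h1, integral_map hA.aemeasurable]
  exact ((hcost_continuous hp n).measurable.comp (by fun_prop)).aestronglyMeasurable

lemma GoodMap.Wp_eq (hp : 1 < p) (h : GoodMap p α β T) [IsProbabilityMeasure α] :
    Wp p (lpDist p) α β = (∫ x, hcost p (x, T x) ∂α) ^ (1 / p) := by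
  have hT := h.1
  unfold Wp
  simp only [lpDist_pow hp]
  refine IsLeast.csInf_eq ⟨⟨α.map fun x => (x, T x), ?_, ?_⟩, ?_⟩
  · exact isCoupling_map measurable_id hT Measure.map_id h.2.1
  · simp only
    congr 1
    exact integral_hcost_map hp α measurable_id hT
  · rintro _ ⟨γ, hγ, rfl⟩
    refine Real.rpow_le_rpow (integral_nonneg fun _ => hcost_nonneg _ _) (h.2.2.1 γ hγ) ?_
    have : 0 < p := by linarith
    positivity

lemma GoodMap.Wp_eq' (hp : 1 < p) (h : GoodMap p α β T) [IsProbabilityMeasure α] :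
    Wp p (lpDist p) β α = (∫ x, hcost p (x, T x) ∂α) ^ (1 / p) := by
  have hT := h.1
  unfold Wp
  simp only [lpDist_pow hp]
  refine IsLeast.csInf_eq ⟨⟨α.map fun x => (T x, x), ?_, ?_⟩, ?_⟩
  · exact isCoupling_map hT measurable_id h.2.1 Measure.map_id
  · simp only
    congr 1
    refine (integral_hcost_map hp α hT measurable_id).trans ?_
    exact integral_congr_ae (ae_of_all _ fun x => hcost_comm _ _ _)
  · rintro _ ⟨γ, hγ, rfl⟩
    have := hγ.1
    refine Real.rpow_le_rpow (integral_nonneg fun _ => hcost_nonneg _ _) ?_ ?_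
    · refine (h.le hp γ measurable_snd measurable_fst hγ.2.2 hγ.2.1).trans_eq ?_
      exact integral_congr_ae (ae_of_all _ fun x => hcost_comm _ _ _)
    have : 0 < p := by linarith
    positivity

/-- the kernel of an optimal coupling (in the reversed order) is a Dirac mass. -/
lemma GoodMap.kernel_eq (hp : 1 < p) (h : GoodMap p α β T) [IsProbabilityMeasure α]
    {κ : Kernel (Vec n) (Vec n)} [IsMarkovKernel κ] {γ : Measure (Vec n × Vec n)}
    (hκ : ∀ A, MeasurableSet A → γ A = ∫⁻ y, κ y {x | (x, y) ∈ A} ∂α)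
    (hγ : IsCoupling γ β α)
    (hopt : (∫ z, lpDist p z.1 z.2 ^ p ∂γ) ^ (1 / p) = Wp p (lpDist p) β α) :
    ∀ᵐ y ∂α, κ y = Measure.dirac (T y) := by
  have hT := h.1
  have := hγ.1
  rw [h.Wp_eq' hp] at hopt
  simp only [lpDist_pow hp] at hopt
  have hp0 : 1 / p ≠ 0 := by
    have : 0 < p := by linarith
    positivity
  have e := rpow_inj_aux hp0 (integral_nonneg fun _ => hcost_nonneg _ _)
    (integral_nonneg fun _ => hcost_nonneg _ _) hopt
  have hu := h.uniq hp γ measurable_snd measurable_fst hγ.2.2 hγ.2.1 (by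
    rw [← e]
    exact (integral_congr_ae (ae_of_all _ fun x => hcost_comm _ _ _)).le)
  have hm : MeasurableSet {z : Vec n × Vec n | z.1 = T z.2} :=
    measurableSet_eq_fun measurable_fst (by fun_prop)
  have h0 : γ {z : Vec n × Vec n | z.1 = T z.2}ᶜ = 0 := hu
  rw [hκ _ hm.compl, lintegral_eq_zero_iff] at h0
  · filter_upwards [h0] with y hy
    have hae : ∀ᵐ x ∂(κ y), x = T y := hy
    have : (κ y).map id = (κ y).map (fun _ => T y) := Measure.map_congr hae
    rw [Measure.map_id, Measure.map_const, measure_univ, one_smul] at this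
    exact this
  · exact Kernel.measurable_kernel_prodMk_left (κ := κ) (measurable_swap hm.compl)

end good

end Final

/-- the L^p(λ) projection onto pairs of maps with prescribed pushforwards
admits the unique solution (T¹ ∘ (X_ρ)₁, T² ∘ (X_ρ)₂); its pushforward is the unique
shadow of ρ onto Π(μ₁,μ₂) and its L^p distance to X_ρ equals W_p(ρ, S(ρ;μ₁,μ₂)). -/
theorem lp_projection_is_shadow
    (d₁ d₂ : ℕ) (X₁ : Set (Vec d₁)) (X₂ : Set (Vec d₂))
    (hX₁c : IsCompact X₁) (hX₂c : IsCompact X₂)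
    (hconv : Convex ℝ (X₁ ×ˢ X₂)) (hbd : volume (frontier (X₁ ×ˢ X₂)) = 0)
    (p : ℝ) (hp : 1 < p)
    (lam : Measure (Vec d₁ × Vec d₂)) (hlam : IsProbabilityMeasure lam) (hlamac : lam ≪ volume)
    (ρ : Measure (Vec d₁ × Vec d₂)) (hρ : ProbOn ρ (X₁ ×ˢ X₂)) (hρac : ρ ≪ volume)
    (μ₁ : Measure (Vec d₁)) (μ₂ : Measure (Vec d₂))
    (hμ₁ : ProbOn μ₁ X₁) (hμ₂ : ProbOn μ₂ X₂)
    (Xρ : Vec d₁ × Vec d₂ → Vec d₁ × Vec d₂) (hXρm : Measurable Xρ)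
    (hXρ : lam.map Xρ = ρ)
    (hXρLp : Integrable (fun z => prodDist p (Xρ z) 0 ^ p) lam) :
    ∃ (T₁ : Vec d₁ → Vec d₁) (T₂ : Vec d₂ → Vec d₂),
      IsOptMap p (lpDist p) (ρ.map Prod.fst) μ₁ T₁ ∧
      IsOptMap p (lpDist p) (ρ.map Prod.snd) μ₂ T₂ ∧
      -- (X₁*, X₂*) := (T¹ ∘ (X_ρ)₁, T² ∘ (X_ρ)₂) minimizes the L^p(λ) distance to X_ρ …
      (∀ (Y₁ : Vec d₁ × Vec d₂ → Vec d₁) (Y₂ : Vec d₁ × Vec d₂ → Vec d₂),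
        Measurable Y₁ → Measurable Y₂ → lam.map Y₁ = μ₁ → lam.map Y₂ = μ₂ →
        (∫ z, prodDist p (T₁ (Xρ z).1, T₂ (Xρ z).2) (Xρ z) ^ p ∂lam) ^ (1 / p) ≤
          (∫ z, prodDist p (Y₁ z, Y₂ z) (Xρ z) ^ p ∂lam) ^ (1 / p)) ∧
      -- … and is the unique (up to λ-a.e. equality) such minimizer …
      (∀ (Y₁ : Vec d₁ × Vec d₂ → Vec d₁) (Y₂ : Vec d₁ × Vec d₂ → Vec d₂),
        Measurable Y₁ → Measurable Y₂ → lam.map Y₁ = μ₁ → lam.map Y₂ = μ₂ →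
        (∫ z, prodDist p (Y₁ z, Y₂ z) (Xρ z) ^ p ∂lam) ^ (1 / p) =
          (∫ z, prodDist p (T₁ (Xρ z).1, T₂ (Xρ z).2) (Xρ z) ^ p ∂lam) ^ (1 / p) →
        (fun z => (Y₁ z, Y₂ z)) =ᵐ[lam] fun z => (T₁ (Xρ z).1, T₂ (Xρ z).2)) ∧
      -- … its pushforward is the unique shadow of ρ onto Π(μ₁,μ₂) …
      (∃! S, IsShadow2 p ρ μ₁ μ₂ S) ∧
      IsShadow2 p ρ μ₁ μ₂ (lam.map fun z => (T₁ (Xρ z).1, T₂ (Xρ z).2)) ∧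
      -- … and ‖(X₁*,X₂*) − X_ρ‖_{L^p(λ)} = W_p(ρ, S(ρ;μ₁,μ₂)).
      (∫ z, prodDist p (T₁ (Xρ z).1, T₂ (Xρ z).2) (Xρ z) ^ p ∂lam) ^ (1 / p) =
        Wp p (prodDist p) ρ (lam.map fun z => (T₁ (Xρ z).1, T₂ (Xρ z).2)) := by
  have hρp := hρ.1
  have hμ₁p := hμ₁.1
  have hμ₂p := hμ₂.1
  have hp0 : 0 < p := by linarith
  have hX₁m := hX₁c.isClosed.measurableSet
  have hX₂m := hX₂c.isClosed.measurableSet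
  have hα₁ : IsProbabilityMeasure (ρ.map Prod.fst) :=
    Measure.isProbabilityMeasure_map measurable_fst.aemeasurable
  have hα₂ : IsProbabilityMeasure (ρ.map Prod.snd) :=
    Measure.isProbabilityMeasure_map measurable_snd.aemeasurable
  have hac₁ : ρ.map Prod.fst ≪ volume :=
    (hρac.map measurable_fst).trans Measure.quasiMeasurePreserving_fst.absolutelyContinuous
  have hac₂ : ρ.map Prod.snd ≪ volume :=
    (hρac.map measurable_snd).trans Measure.quasiMeasurePreserving_snd.absolutelyContinuous
  have hα₁K : ρ.map Prod.fst X₁ᶜ = 0 := by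
    rw [Measure.map_apply measurable_fst hX₁m.compl]
    refine measure_mono_null ?_ hρ.2
    intro z hz h
    exact hz h.1
  have hα₂K : ρ.map Prod.snd X₂ᶜ = 0 := by
    rw [Measure.map_apply measurable_snd hX₂m.compl]
    refine measure_mono_null ?_ hρ.2
    intro z hz h
    exact hz h.2
  obtain ⟨T₁, G₁⟩ : ∃ T, GoodMap p (ρ.map Prod.fst) μ₁ T :=
    core hp hα₁ hμ₁p hac₁ hX₁c hX₁c hα₁K hμ₁.2
  obtain ⟨T₂, G₂⟩ : ∃ T, GoodMap p (ρ.map Prod.snd) μ₂ T :=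
    core hp hα₂ hμ₂p hac₂ hX₂c hX₂c hα₂K hμ₂.2
  have hT₁ := G₁.1
  have hT₂ := G₂.1
  have hx₁ : lam.map (fun z => (Xρ z).1) = ρ.map Prod.fst := by
    rw [← hXρ, Measure.map_map measurable_fst hXρm]; rfl
  have hx₂ : lam.map (fun z => (Xρ z).2) = ρ.map Prod.snd := by
    rw [← hXρ, Measure.map_map measurable_snd hXρm]; rfl
  have hxm₁ : Measurable (fun z => (Xρ z).1) := by fun_prop
  have hxm₂ : Measurable (fun z => (Xρ z).2) := by fun_prop
  have ht₁ : lam.map (fun z => T₁ (Xρ z).1) = μ₁ := by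
    rw [← G₁.2.1, ← hx₁, Measure.map_map hT₁ hxm₁]; rfl
  have ht₂ : lam.map (fun z => T₂ (Xρ z).2) = μ₂ := by
    rw [← G₂.2.1, ← hx₂, Measure.map_map hT₂ hxm₂]; rfl
  have htm₁ : Measurable (fun z => T₁ (Xρ z).1) := by fun_prop
  have htm₂ : Measurable (fun z => T₂ (Xρ z).2) := by fun_prop
  -- the objective splits
  have split : ∀ (Y₁ : Vec d₁ × Vec d₂ → Vec d₁) (Y₂ : Vec d₁ × Vec d₂ → Vec d₂),
      Measurable Y₁ → Measurable Y₂ → lam.map Y₁ = μ₁ → lam.map Y₂ = μ₂ →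
      ∫ z, prodDist p (Y₁ z, Y₂ z) (Xρ z) ^ p ∂lam =
        (∫ z, hcost p ((Xρ z).1, Y₁ z) ∂lam) + ∫ z, hcost p ((Xρ z).2, Y₂ z) ∂lam := by
    intro Y₁ Y₂ h1 h2 h3 h4
    rw [← integral_add (hcost_integrable hp lam hxm₁ h1 hx₁ h3 hX₁c hX₁c hα₁K hμ₁.2)
      (hcost_integrable hp lam hxm₂ h2 hx₂ h4 hX₂c hX₂c hα₂K hμ₂.2)]
    refine integral_congr_ae (Filter.Eventually.of_forall fun z => ?_)
    simp only
    rw [prodDist_pow hp, hcost_comm, hcost_comm p (Y₂ z)]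
  have hval := split _ _ htm₁ htm₂ ht₁ ht₂
  rw [G₁.cost_eq hp lam hxm₁ hx₁, G₂.cost_eq hp lam hxm₂ hx₂] at hval
  set m₁ := ∫ x, hcost p (x, T₁ x) ∂(ρ.map Prod.fst) with hm₁
  set m₂ := ∫ x, hcost p (x, T₂ x) ∂(ρ.map Prod.snd) with hm₂
  have hm₁0 : 0 ≤ m₁ := integral_nonneg fun _ => hcost_nonneg _ _
  have hm₂0 : 0 ≤ m₂ := integral_nonneg fun _ => hcost_nonneg _ _
  have hS : lam.map (fun z => (T₁ (Xρ z).1, T₂ (Xρ z).2)) = ρ.map (fun y => (T₁ y.1, T₂ y.2)) := by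
    rw [← hXρ, Measure.map_map (by fun_prop) hXρm]; rfl
  have hshadow : IsShadow2 p ρ μ₁ μ₂ (lam.map fun z => (T₁ (Xρ z).1, T₂ (Xρ z).2)) := by
    refine ⟨Kernel.deterministic T₁ hT₁, Kernel.deterministic T₂ hT₂, inferInstance, inferInstance,
      ⟨(ρ.map Prod.fst).map fun x => (T₁ x, x), ?_, ?_, ?_⟩,
      ⟨(ρ.map Prod.snd).map fun x => (T₂ x, x), ?_, ?_, ?_⟩, ?_⟩
    · intro A hA
      rw [← lintegral_indicator_one hA, lintegral_map (measurable_one.indicator hA) (by fun_prop)]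
      refine lintegral_congr fun y => ?_
      have hA' : MeasurableSet {x | (x, y) ∈ A} := measurable_prodMk_right hA
      rw [Kernel.deterministic_apply' _ _ hA']
      rfl
    · exact isCoupling_map hT₁ measurable_id G₁.2.1 Measure.map_id
    · rw [G₁.Wp_eq' hp]
      congr 1
      simp only [lpDist_pow hp]
      refine (integral_hcost_map hp _ hT₁ measurable_id).trans ?_
      exact integral_congr_ae (ae_of_all _ fun x => hcost_comm _ _ _)
    · intro A hA
      rw [← lintegral_indicator_one hA, lintegral_map (measurable_one.indicator hA) (by fun_prop)]
      refine lintegral_congr fun y => ?_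
      have hA' : MeasurableSet {x | (x, y) ∈ A} := measurable_prodMk_right hA
      rw [Kernel.deterministic_apply' _ _ hA']
      rfl
    · exact isCoupling_map hT₂ measurable_id G₂.2.1 Measure.map_id
    · rw [G₂.Wp_eq' hp]
      congr 1
      simp only [lpDist_pow hp]
      refine (integral_hcost_map hp _ hT₂ measurable_id).trans ?_
      exact integral_congr_ae (ae_of_all _ fun x => hcost_comm _ _ _)
    · intro A hA
      rw [hS, ← lintegral_indicator_one hA,
        lintegral_map (measurable_one.indicator hA) (by fun_prop)]
      refine lintegral_congr fun y => ?_
      rw [Kernel.deterministic_apply, Kernel.deterministic_apply, Measure.dirac_prod_dirac,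
        Measure.dirac_apply' _ hA]
  refine ⟨T₁, T₂, ⟨hT₁, G₁.2.1, ?_⟩, ⟨hT₂, G₂.2.1, ?_⟩, ?_, ?_, ⟨_, hshadow, ?_⟩, hshadow, ?_⟩
  · rw [G₁.Wp_eq hp]; simp only [lpDist_pow hp]
  · rw [G₂.Wp_eq hp]; simp only [lpDist_pow hp]
  · intro Y₁ Y₂ h1 h2 h3 h4
    rw [hval, split Y₁ Y₂ h1 h2 h3 h4]
    refine Real.rpow_le_rpow (by positivity) ?_ (by positivity)
    exact add_le_add (G₁.le hp lam hxm₁ h1 hx₁ h3) (G₂.le hp lam hxm₂ h2 hx₂ h4)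
  · intro Y₁ Y₂ h1 h2 h3 h4 heq
    rw [hval, split Y₁ Y₂ h1 h2 h3 h4] at heq
    have e := rpow_inj_aux (show 1 / p ≠ 0 by positivity)
      (add_nonneg (integral_nonneg fun _ => hcost_nonneg _ _)
        (integral_nonneg fun _ => hcost_nonneg _ _)) (add_nonneg hm₁0 hm₂0) heq
    have l1 := G₁.le hp lam hxm₁ h1 hx₁ h3
    have l2 := G₂.le hp lam hxm₂ h2 hx₂ h4
    rw [← hm₁] at l1
    rw [← hm₂] at l2
    have u1 := G₁.uniq hp lam hxm₁ h1 hx₁ h3 (by linarith)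
    have u2 := G₂.uniq hp lam hxm₂ h2 hx₂ h4 (by linarith)
    filter_upwards [u1, u2] with z hz1 hz2
    rw [hz1, hz2]
  · rintro S ⟨κ₁, κ₂, hk1, hk2, ⟨γ₁, a1, a2, a3⟩, ⟨γ₂, b1, b2, b3⟩, hSA⟩
    have e1 := ae_of_ae_map measurable_fst.aemeasurable (G₁.kernel_eq hp a1 a2 a3)
    have e2 := ae_of_ae_map measurable_snd.aemeasurable (G₂.kernel_eq hp b1 b2 b3)
    rw [hS]
    ext A hA
    rw [hSA A hA, ← lintegral_indicator_one hA,
        lintegral_map (measurable_one.indicator hA) (by fun_prop)]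
    refine lintegral_congr_ae ?_
    filter_upwards [e1, e2] with y hy1 hy2
    rw [hy1, hy2, Measure.dirac_prod_dirac, Measure.dirac_apply' _ hA]
  · rw [hval]
    symm
    unfold Wp
    simp only [prodDist_pow hp]
    refine IsLeast.csInf_eq
      ⟨⟨lam.map fun z => (Xρ z, (T₁ (Xρ z).1, T₂ (Xρ z).2)), ?_, ?_⟩, ?_⟩
    · exact isCoupling_map hXρm (by fun_prop) hXρ rfl
    · simp only
      congr 1
      rw [← hval, integral_map (by fun_prop)]
      · refine integral_congr_ae (Filter.Eventually.of_forall fun z => ?_)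
        simp only
        rw [prodDist_pow hp, hcost_comm, hcost_comm p (Xρ z).2]
      · have c1 := (hcost_continuous hp d₁).measurable
        have c2 := (hcost_continuous hp d₂).measurable
        exact ((c1.comp (by fun_prop)).add (c2.comp (by fun_prop))).aestronglyMeasurable
    · rintro _ ⟨γ, hγ, rfl⟩
      have hγp := hγ.1
      have q1 : γ.map (fun z => z.1.1) = ρ.map Prod.fst := by
        rw [← hγ.2.1, Measure.map_map measurable_fst measurable_fst]; rfl
      have q2 : γ.map (fun z => z.1.2) = ρ.map Prod.snd := by
        rw [← hγ.2.1, Measure.map_map measurable_snd measurable_fst]; rfl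
      have q3 : γ.map (fun z => z.2.1) = μ₁ := by
        have : γ.map (fun z => z.2.1) = (γ.map Prod.snd).map Prod.fst := by
          rw [Measure.map_map measurable_fst measurable_snd]; rfl
        rw [this, hγ.2.2, Measure.map_map measurable_fst (by fun_prop)]
        exact ht₁
      have q4 : γ.map (fun z => z.2.2) = μ₂ := by
        have : γ.map (fun z => z.2.2) = (γ.map Prod.snd).map Prod.snd := by
          rw [Measure.map_map measurable_snd measurable_snd]; rfl
        rw [this, hγ.2.2, Measure.map_map measurable_snd (by fun_prop)]
        exact ht₂
      refine Real.rpow_le_rpow (by positivity) ?_ (by positivity)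
      rw [integral_add (hcost_integrable hp γ (by fun_prop) (by fun_prop) q1 q3 hX₁c hX₁c
          hα₁K hμ₁.2)
        (hcost_integrable hp γ (by fun_prop) (by fun_prop) q2 q4 hX₂c hX₂c hα₂K hμ₂.2)]
      exact add_le_add (G₁.le hp γ (by fun_prop) (by fun_prop) q1 q3)
        (G₂.le hp γ (by fun_prop) (by fun_prop) q2 q4)


end
end
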